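/- arXiv:2603.03139 — 5 statements merged into one kernel-verified Lean document; each statement's English description precedes it below -/
import Mathlib

section
/- Let G = (V,E) be an s-connector and let 𝒢 = (G_0,G_1,…,G_q) be a fully-coloured q-multicolouring of G with ν(G_j) ≤ |V|/2 − s for all j ∈ {1,…,q}. Then there exist a set T ⊆ V, a colour η ∈ {1,…,q}, and an integer κ such that: (1) 2κ + 1 ≥ |V| − |T| − (q+13)(s−1); (2) ν(G_η) ≥ κ; and (3) Σ_{j=1}^q ν(G_j) ≥ κ + |T|. -/
open SimpleGraph

variable {V : Type*}

/-- `M` is a set of edges of `G` forming a matching (pairwise disjoint edges). -/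
def IsMatchingSet (G : SimpleGraph V) (M : Finset (Sym2 V)) : Prop :=
  (∀ e ∈ M, e ∈ G.edgeSet) ∧
    ∀ e ∈ M, ∀ f ∈ M, e ≠ f → ∀ v : V, v ∈ e → v ∉ f

/-- The matching number `ν(G)`. -/
noncomputable def matchingNumber (G : SimpleGraph V) : ℕ :=
  sSup {n | ∃ M : Finset (Sym2 V), IsMatchingSet G M ∧ M.card = n}

/-- `ν_G(X,Y)`: the maximum size of a matching of `G` each edge of which has one
endpoint in `X` and one endpoint in `Y`. -/
noncomputable def nuBetween (G : SimpleGraph V) (X Y : Set V) : ℕ :=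
  sSup {n | ∃ M : Finset (Sym2 V), IsMatchingSet G M ∧ M.card = n ∧
    ∀ e ∈ M, ∃ x ∈ X, ∃ y ∈ Y, e = s(x, y)}

/-- The set `D` of the Gallai–Edmonds decomposition: the inessential vertices,
i.e. those missed by some maximum matching. -/
def geD (G : SimpleGraph V) : Set V :=
  {v | ∃ M : Finset (Sym2 V), IsMatchingSet G M ∧ M.card = matchingNumber G ∧ ∀ e ∈ M, v ∉ e}

/-- The set `A` of the Gallai–Edmonds decomposition: vertices outside `D` with a
neighbour in `D`. -/
def geA (G : SimpleGraph V) : Set V :=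
  {v | v ∉ geD G ∧ ∃ u ∈ geD G, G.Adj v u}

/-- The set `C` of the Gallai–Edmonds decomposition: the remaining vertices. -/
def geC (G : SimpleGraph V) : Set V :=
  {v | v ∉ geD G ∧ v ∉ geA G}

/-- `G` is an `s`-connector: any two disjoint vertex sets of size at least `s`
are joined by an edge. -/
def IsConnector (G : SimpleGraph V) (s : ℕ) : Prop :=
  ∀ X Y : Set V, Disjoint X Y → s ≤ X.ncard → s ≤ Y.ncard →
    ∃ x ∈ X, ∃ y ∈ Y, G.Adj x y

/-- `G → (t₁K₂, …, t_qK₂)`: every `q`-colouring of the edges of `G` admits a colour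
`j` and a `j`-monochromatic matching of size `t j`. -/
def ArrowsMatch (G : SimpleGraph V) {q : ℕ} (t : Fin q → ℕ) : Prop :=
  ∀ c : Sym2 V → Fin q, ∃ j : Fin q, ∃ M : Finset (Sym2 V),
    IsMatchingSet G M ∧ M.card = t j ∧ ∀ e ∈ M, c e = j

/-- The induced subgraph `G[S]`, viewed as a graph on the same vertex set. -/
def inducedOn (G : SimpleGraph V) (S : Set V) : SimpleGraph V where
  Adj a b := G.Adj a b ∧ a ∈ S ∧ b ∈ S
  symm := ⟨fun _ _ ⟨h, ha, hb⟩ => ⟨h.symm, hb, ha⟩⟩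
  loopless := ⟨fun a h => G.loopless.irrefl a h.1⟩

/-- Remove from `G` every edge incident to `S`. -/
def removeIncident (G : SimpleGraph V) (S : Set V) : SimpleGraph V where
  Adj a b := G.Adj a b ∧ a ∉ S ∧ b ∉ S
  symm := ⟨fun _ _ ⟨h, ha, hb⟩ => ⟨h.symm, hb, ha⟩⟩
  loopless := ⟨fun a h => G.loopless.irrefl a h.1⟩

/-- The subgraph of `G` consisting of the edges incident to `S`. -/
def incidentSub (G : SimpleGraph V) (S : Set V) : SimpleGraph V where
  Adj a b := G.Adj a b ∧ (a ∈ S ∨ b ∈ S)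
  symm := ⟨fun _ _ ⟨h, hs⟩ => ⟨h.symm, hs.symm⟩⟩
  loopless := ⟨fun a h => G.loopless.irrefl a h.1⟩

/-- The vertex set of the connected component of `v` in `G`. -/
def compSet (G : SimpleGraph V) (v : V) : Set V := {u | G.Reachable u v}

/-- The family of vertex sets of the connected components of `G[S]` meeting `S`. -/
def compsOn (G : SimpleGraph V) (S : Set V) : Set (Set V) :=
  {K | ∃ v ∈ S, K = compSet (inducedOn G S) v}

/-- `G[S]` is factor-critical: for every `v ∈ S` there is a matching of `G[S]`
avoiding `v` and covering all other vertices of `S`. -/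
def IsFactorCriticalOn (G : SimpleGraph V) (S : Set V) : Prop :=
  ∀ v ∈ S, ∃ M : Finset (Sym2 V), IsMatchingSet (inducedOn G S) M ∧
    (∀ e ∈ M, v ∉ e) ∧ ∀ u ∈ S, u ≠ v → ∃ e ∈ M, u ∈ e

/-- The bipartite incidence graph of an indexed (multi)hypergraph. -/
def incGraph {ι : Type*} (E : ι → Set V) : SimpleGraph (V ⊕ ι) where
  Adj x y :=
    (∃ v i, x = Sum.inl v ∧ y = Sum.inr i ∧ v ∈ E i) ∨
    (∃ v i, x = Sum.inr i ∧ y = Sum.inl v ∧ v ∈ E i)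
  symm := by
    constructor
    rintro x y (⟨v, i, rfl, rfl, h⟩ | ⟨v, i, rfl, rfl, h⟩)
    · exact Or.inr ⟨v, i, rfl, rfl, h⟩
    · exact Or.inl ⟨v, i, rfl, rfl, h⟩
  loopless := by
    constructor
    rintro x (⟨v, i, rfl, h, -⟩ | ⟨v, i, rfl, h, -⟩) <;> simp at h

/-- An indexed (multi)hypergraph is a hyperforest if its incidence graph has no cycle. -/
def IsHyperforest {ι : Type*} (E : ι → Set V) : Prop := (incGraph E).IsAcyclic

/-- Index type of the multihypergraph `𝒞(𝒢)` of monochromatic connected components: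
a colour together with the vertex set of a component of that colour graph. -/
def CompIdx {q : ℕ} (Gc : Fin q → SimpleGraph V) : Type _ :=
  Σ j : Fin q, {K : Set V // ∃ v : V, K = compSet (Gc j) v}

/-- The hyperedges of the multihypergraph `𝒞(𝒢)`. -/
def CompEdge {q : ℕ} (Gc : Fin q → SimpleGraph V) : CompIdx Gc → Set V :=
  fun p => (p.2 : Set V)

/-- A coloured graph is acyclic if `𝒞(𝒢)` is a hyperforest. -/
def ColouringAcyclic {q : ℕ} (Gc : Fin q → SimpleGraph V) : Prop :=
  IsHyperforest (CompEdge Gc)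

/-- `(G₀, G₁, …, G_q)` is a `q`-multicolouring of `G`: the union of all
(coloured and uncoloured) edge sets is the edge set of `G`. -/
def IsMulticolouring (G G0 : SimpleGraph V) {q : ℕ} (Gc : Fin q → SimpleGraph V) : Prop :=
  G0 ⊔ (⨆ j, Gc j) = G

/-- The colouring `(G₀, G₁, …, G_q)` of `G` is `S`-proper: the uncoloured edges are
exactly the edges of `G` incident to `S`, and they carry no colour. -/
def IsSProper (G G0 : SimpleGraph V) {q : ℕ} (Gc : Fin q → SimpleGraph V) (S : Set V) : Prop :=
  G0.edgeSet = {e | e ∈ G.edgeSet ∧ ∃ v ∈ S, v ∈ e} ∧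
    ∀ j, Disjoint G0.edgeSet (Gc j).edgeSet

/-- The potential `σ_𝒢(T) = r_𝒢(T) - |T|`, where
`r_𝒢(T) = ∑_j |A_j ∩ T| + ∑_j ∑_i (ν(G_j[K_j^i]) - ν(G_j[K_j^i ∖ T]))`,
the inner sum running over the components `K_j^i` of `G_j[D_j]`. -/
noncomputable def sigmaCol {q : ℕ} (Gc : Fin q → SimpleGraph V) (T : Set V) : ℤ :=
  ((∑ j : Fin q, ((geA (Gc j) ∩ T).ncard : ℤ))
    + ∑ j : Fin q, ∑ᶠ K ∈ compsOn (Gc j) (geD (Gc j)),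
        ((matchingNumber (inducedOn (Gc j) K) : ℤ)
          - (matchingNumber (inducedOn (Gc j) (K \ T)) : ℤ)))
    - (T.ncard : ℤ)

/-- `T` is `σ_𝒢`-maximal. -/
def SigmaMaximal {q : ℕ} (Gc : Fin q → SimpleGraph V) (T : Set V) : Prop :=
  (∀ S : Set V, sigmaCol Gc S ≤ sigmaCol Gc T) ∧
    ∀ T' : Set V, T ⊂ T' → sigmaCol Gc T' < sigmaCol Gc T

/-- A set closed under a fixed-point-free involution has even cardinality. -/
lemma even_card_of_involution {α : Type*} (f : α → α) (hf : ∀ v, f (f v) = v)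
    (A : Finset α) (hA : ∀ v ∈ A, f v ∈ A) (hfix : ∀ v ∈ A, f v ≠ v) : Even A.card := by
  have h : ∑ _v ∈ A, (1 : ZMod 2) = 0 :=
    Finset.sum_involution (fun v _ => f v) (fun _ _ => by decide)
      (fun v hv _ => hfix v hv) hA (fun v _ => hf v)
  rw [Finset.sum_const, nsmul_eq_mul, mul_one] at h
  exact (ZMod.natCast_eq_zero_iff_even).1 h

/-- An involution of `V` moving only vertices of `S`, along edges of `H`: this encodes a
matching of `H[S]`, the fixed points being the uncovered vertices. -/
def IsMatchingInvolution (H : SimpleGraph V) (S : Finset V) (f : V → V) : Prop :=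
  (∀ v, f (f v) = v) ∧ ∀ v, f v ≠ v → v ∈ S ∧ H.Adj v (f v)

section Involutions

open Finset
open scoped Classical

lemma IsMatchingInvolution.mono {H : SimpleGraph V} {S T : Finset V} {f : V → V}
    (hf : IsMatchingInvolution H S f) (h : S ⊆ T) : IsMatchingInvolution H T f :=
  ⟨hf.1, fun v hv => ⟨h (hf.2 v hv).1, (hf.2 v hv).2⟩⟩

variable [Fintype V]

/-- The vertices covered by a matching involution. -/
noncomputable def covered (f : V → V) : Finset V := univ.filter fun v => f v ≠ v

lemma mem_covered {f : V → V} {v : V} : v ∈ covered f ↔ f v ≠ v := by simp [covered]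

/-- The largest number of vertices covered by a matching of `H[S]`. -/
noncomputable def maxCovered (H : SimpleGraph V) (S : Finset V) : ℕ :=
  (univ.filter (IsMatchingInvolution H S)).sup fun f => (covered f).card

/-- A matching of `H[S]` of maximum size. -/
def IsMaxMatchingInvolution (H : SimpleGraph V) (S : Finset V) (f : V → V) : Prop :=
  IsMatchingInvolution H S f ∧ (covered f).card = maxCovered H S

lemma IsMatchingInvolution.card_le {H : SimpleGraph V} {S : Finset V} {f : V → V}
    (hf : IsMatchingInvolution H S f) : (covered f).card ≤ maxCovered H S :=
  Finset.le_sup (f := fun f : V → V => (covered f).card) (by simpa using hf)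

lemma exists_isMaxMatchingInvolution (H : SimpleGraph V) (S : Finset V) :
    ∃ f, IsMaxMatchingInvolution H S f := by
  obtain ⟨f, hf, h⟩ := Finset.exists_mem_eq_sup (univ.filter (IsMatchingInvolution H S))
    ⟨id, by simp [IsMatchingInvolution]⟩ (fun f => (covered f).card)
  exact ⟨f, by simpa using hf, h.symm⟩

lemma maxCovered_mono (H : SimpleGraph V) {S T : Finset V} (h : S ⊆ T) :
    maxCovered H S ≤ maxCovered H T := by
  obtain ⟨f, hf, hc⟩ := exists_isMaxMatchingInvolution H S
  exact hc ▸ (hf.mono h).card_le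

lemma IsMatchingInvolution.even_card {H : SimpleGraph V} {S : Finset V} {f : V → V}
    (hf : IsMatchingInvolution H S f) : Even (covered f).card :=
  even_card_of_involution f hf.1 _
    (fun v hv => by rw [mem_covered, hf.1]; exact (mem_covered.1 hv).symm)
    (fun v hv => mem_covered.1 hv)

lemma even_maxCovered (H : SimpleGraph V) (S : Finset V) : Even (maxCovered H S) := by
  obtain ⟨f, hf, hc⟩ := exists_isMaxMatchingInvolution H S
  exact hc ▸ hf.even_card

lemma card_le_two_mul_matchingNumber {H : SimpleGraph V} {S : Finset V} {f : V → V}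
    (hf : IsMatchingInvolution H S f) : (covered f).card ≤ 2 * matchingNumber H := by
  set M : Finset (Sym2 V) := (covered f).image fun v => s(v, f v) with hM
  have hcard : (covered f).card ≤ 2 * M.card := by
    refine Finset.card_le_mul_card_image _ 2 fun e he => ?_
    obtain ⟨w, hw, rfl⟩ := Finset.mem_image.1 he
    refine (Finset.card_le_card (t := {w, f w}) fun v hv => ?_).trans Finset.card_le_two
    have := (Finset.mem_filter.1 hv).2
    rw [Sym2.eq_iff] at this
    simp only [Finset.mem_insert, Finset.mem_singleton]
    tauto
  have hmatch : IsMatchingSet H M := by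
    refine ⟨fun e he => ?_, fun e he e' he' hne v hv hv' => hne ?_⟩
    · obtain ⟨w, hw, rfl⟩ := Finset.mem_image.1 he
      exact (hf.2 w (mem_covered.1 hw)).2
    · have key : ∀ e ∈ M, v ∈ e → e = s(v, f v) := by
        intro e he hv
        obtain ⟨w, hw, rfl⟩ := Finset.mem_image.1 he
        rcases Sym2.mem_iff.1 hv with rfl | rfl
        · rfl
        · rw [hf.1, Sym2.eq_swap]
      rw [key e he hv, key e' he' hv']
  have hle : M.card ≤ matchingNumber H := by
    refine le_csSup ⟨Fintype.card (Sym2 V), ?_⟩ ⟨M, hmatch, rfl⟩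
    rintro n ⟨N, -, rfl⟩
    exact Finset.card_le_univ N
  omega

lemma maxCovered_le_two_mul_matchingNumber (H : SimpleGraph V) (S : Finset V) :
    maxCovered H S ≤ 2 * matchingNumber H := by
  obtain ⟨f, hf, hc⟩ := exists_isMaxMatchingInvolution H S
  exact hc ▸ card_le_two_mul_matchingNumber hf

/-- Two uncovered vertices of a maximum matching are not adjacent. -/
lemma IsMaxMatchingInvolution.not_adj {H : SimpleGraph V} {S : Finset V} {f : V → V}
    (hf : IsMaxMatchingInvolution H S f) {u v : V} (hu : u ∈ S) (hv : v ∈ S)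
    (hfu : f u = u) (hfv : f v = v) : ¬ H.Adj u v := by
  intro h
  have huv := h.ne
  obtain ⟨⟨hinv, hadj⟩, hcard⟩ := hf
  set g : V → V := fun w => if w = u then v else if w = v then u else f w with hg
  have hgm : IsMatchingInvolution H S g := by
    refine ⟨fun w => ?_, fun w hw => ?_⟩
    · have := hinv w
      grind
    · have := h.symm
      grind
  have hsub : covered f ⊂ covered g := by
    refine Finset.ssubset_iff_subset_ne.2 ⟨fun w hw => ?_, fun heq => ?_⟩
    · rw [mem_covered] at *
      grind
    · have : u ∈ covered g := by rw [mem_covered]; grind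
      rw [← heq, mem_covered] at this
      exact this hfu
  have := Finset.card_lt_card hsub
  have := hgm.card_le
  omega

/-- Among the vertices missed by maximum matchings, being never missed together (or being equal)
is a transitive relation. This is the core of Gallai's lemma. -/
lemma not_both_missed_trans {H : SimpleGraph V} {S : Finset V} {u t v : V}
    (ht : ∃ f, IsMaxMatchingInvolution H S f ∧ f t = t)
    (hut : ∀ f, IsMaxMatchingInvolution H S f → f u = u → f t ≠ t)
    (htv : ∀ f, IsMaxMatchingInvolution H S f → f t = t → f v ≠ v)
    (huv : u ≠ v) {f : V → V} (hf : IsMaxMatchingInvolution H S f) (hfu : f u = u) :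
    f v ≠ v := by
  intro hfv
  obtain ⟨g, hg, hmax⟩ := Finset.exists_max_image
    (univ.filter fun g => IsMaxMatchingInvolution H S g ∧ g t = t)
    (fun g => (univ.filter fun w => g w = f w).card)
    (by obtain ⟨g, hg⟩ := ht; exact ⟨g, by simpa using hg⟩)
  simp only [Finset.mem_filter, Finset.mem_univ, true_and] at hg hmax
  obtain ⟨hg, hgt⟩ := hg
  have hgu : g u ≠ u := fun h => hut g hg h hgt
  have hgv : g v ≠ v := htv g hg hgt
  have hft : f t ≠ t := hut f hf hfu
  -- a second vertex covered by `f` and missed by `g`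
  obtain ⟨x, hfx, hgx, hxt⟩ : ∃ x, f x ≠ x ∧ g x = x ∧ x ≠ t := by
    by_contra! hcon
    have h1 : (covered f \ covered g).card = (covered g \ covered f).card := by
      have h := hf.2.trans hg.2.symm
      have h2 := Finset.card_sdiff_add_card_inter (covered f) (covered g)
      have h3 := Finset.card_sdiff_add_card_inter (covered g) (covered f)
      rw [Finset.inter_comm] at h3
      omega
    have h2 : (covered f \ covered g) ⊆ {t} := by
      intro x hx
      simp only [Finset.mem_sdiff, mem_covered, not_not] at hx
      exact Finset.mem_singleton.2 (by_contra fun h => h (hcon x hx.1 hx.2))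
    have h3 : ({u, v} : Finset V) ⊆ covered g \ covered f := by
      intro x hx
      simp only [Finset.mem_insert, Finset.mem_singleton] at hx
      simp only [Finset.mem_sdiff, mem_covered, not_not]
      rcases hx with rfl | rfl <;> exact ⟨by assumption, by assumption⟩
    have h4 := Finset.card_le_card h2
    have h5 := Finset.card_le_card h3
    rw [Finset.card_pair huv] at h5
    rw [Finset.card_singleton] at h4
    omega
  have hxS := hf.1.2 x hfx
  set y := f x with hy
  have hfy : f y = x := hf.1.1 x
  have hyS := hf.1.2 y (by rw [hfy]; exact hfx.symm)
  have hgy : g y ≠ y := fun h => hg.not_adj hxS.1 hyS.1 hgx h hxS.2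
  set z := g y with hz
  have hgz : g z = y := hg.1.1 y
  have hzx : z ≠ x := fun h => by
    rw [h, hgx] at hgz
    exact hfx hgz.symm
  -- replace the edge `yz` of `g` by the edge `xy` of `f`
  set k : V → V := fun w => if w = x then y else if w = y then x else if w = z then z else g w
    with hk
  have hkm : IsMatchingInvolution H S k := by
    refine ⟨fun w => ?_, fun w hw => ?_⟩
    · have h1 := hg.1.1 w
      have h2 := hg.1.1 x
      grind
    · have h1 := hg.1.2 w
      have h2 := hxS.2.symm
      grind
  have hkc : (covered k).card = (covered g).card := by
    have : covered k = insert x ((covered g).erase z) := by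
      ext w
      simp only [Finset.mem_insert, Finset.mem_erase, mem_covered]
      grind
    rw [this, Finset.card_insert_of_notMem (by simp [mem_covered, hgx]),
      Finset.card_erase_add_one (by rw [mem_covered, hgz]; exact hgy.symm)]
  have hkt : k t = t := by grind
  refine absurd (hmax k ⟨⟨hkm, hkc.trans hg.2⟩, hkt⟩) (not_le.2 (Finset.card_lt_card ?_))
  refine Finset.ssubset_iff_subset_ne.2 ⟨fun w hw => ?_, fun heq => ?_⟩
  · simp only [Finset.mem_filter, Finset.mem_univ, true_and] at hw ⊢
    have h1 := hf.1.1 w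
    grind
  · have : x ∈ univ.filter fun w => k w = f w := by simp [hk, ← hy]
    rw [← heq] at this
    simp only [Finset.mem_filter, Finset.mem_univ, true_and] at this
    exact hfx (this.symm.trans hgx)

/-- Equivalence of vertices that are never missed together by a maximum matching of `H[S]`,
when no vertex is essential. -/
def missedSetoid (H : SimpleGraph V) (S : Finset V)
    (hD : ∀ t, ∃ f, IsMaxMatchingInvolution H S f ∧ f t = t) : Setoid V where
  r u v := u = v ∨ ∀ f, IsMaxMatchingInvolution H S f → f u = u → f v ≠ v
  iseqv :=
    { refl := fun _ => Or.inl rfl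
      symm := by
        rintro u v (rfl | h)
        · exact Or.inl rfl
        · exact Or.inr fun f hf hv hu => h f hf hu hv
      trans := by
        rintro u t v (rfl | h) (rfl | h')
        · exact Or.inl rfl
        · exact Or.inr h'
        · exact Or.inr h
        · by_cases huv : u = v
          · exact Or.inl huv
          · exact Or.inr fun f hf hu => not_both_missed_trans (hD t) h h' huv hf hu }

section Classes

variable {H : SimpleGraph V} {S : Finset V}
  (hD : ∀ t, ∃ f, IsMaxMatchingInvolution H S f ∧ f t = t)

lemma missedSetoid_of_adj {u v : V} (hu : u ∈ S) (hv : v ∈ S) (h : H.Adj u v) :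
    missedSetoid H S hD u v :=
  Or.inr fun _ hf hfu hfv => hf.not_adj hu hv hfu hfv h

lemma missedSetoid_apply {f : V → V} (hf : IsMatchingInvolution H S f) (v : V) :
    missedSetoid H S hD v (f v) := by
  by_cases h : f v = v
  · rw [h]
  · refine missedSetoid_of_adj hD (hf.2 v h).1 (hf.2 (f v) ?_).1 (hf.2 v h).2
    rw [hf.1]
    exact Ne.symm h

lemma mem_of_missedSetoid {u v : V} (h : missedSetoid H S hD u v) (huv : u ≠ v) : u ∈ S := by
  by_contra hu
  obtain ⟨f, hf, hfv⟩ := hD v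
  rcases h with h | h
  · exact huv h
  · exact h f hf (by_contra fun hfu => hu (hf.1.2 u hfu).1) hfv

lemma even_card_covered_class {f : V → V} (hf : IsMatchingInvolution H S f)
    (c : Quotient (missedSetoid H S hD)) :
    Even ((covered f).filter fun v => Quotient.mk _ v = c).card := by
  refine even_card_of_involution f hf.1 _ (fun v hv => ?_) (fun v hv => ?_)
  · rw [Finset.mem_filter, mem_covered] at hv ⊢
    refine ⟨by rw [hf.1]; exact hv.1.symm, ?_⟩
    rw [← hv.2]
    exact Quotient.sound ((missedSetoid H S hD).symm (missedSetoid_apply hD hf v))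
  · exact mem_covered.1 (Finset.mem_filter.1 hv).1

/-- A maximum matching misses at most one vertex of each class. -/
lemma card_class_le {f : V → V} (hf : IsMaxMatchingInvolution H S f)
    (c : Quotient (missedSetoid H S hD)) :
    (univ.filter fun v => Quotient.mk (missedSetoid H S hD) v = c).card ≤
      ((covered f).filter fun v => Quotient.mk _ v = c).card + 1 := by
  have hmiss :
      (univ.filter fun v => Quotient.mk (missedSetoid H S hD) v = c ∧ f v = v).card ≤ 1 := by
    refine Finset.card_le_one.2 fun u hu v hv => ?_
    simp only [Finset.mem_filter, Finset.mem_univ, true_and] at hu hv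
    rcases Quotient.exact (hu.1.trans hv.1.symm) with h | h
    · exact h
    · exact absurd hv.2 (h f hf hu.2)
  refine le_trans (Finset.card_le_card ?_) ((Finset.card_union_le _ _).trans
    (Nat.add_le_add_left hmiss _))
  intro v hv
  simp only [Finset.mem_union, Finset.mem_filter, Finset.mem_univ, true_and, mem_covered] at hv ⊢
  tauto

lemma card_class_le_maxCovered (c : Quotient (missedSetoid H S hD)) :
    (univ.filter fun v => Quotient.mk (missedSetoid H S hD) v = c).card ≤ maxCovered H S + 1 := by
  obtain ⟨f, hf⟩ := exists_isMaxMatchingInvolution H S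
  exact (card_class_le hD hf c).trans
    (Nat.add_le_add_right (hf.2 ▸ Finset.card_le_card (Finset.filter_subset _ _)) 1)

/-- Deleting `W` lowers the matching number by at least the number of classes that contain two
vertices of `W`. -/
lemma maxCovered_sdiff_add_le (W : Finset V) :
    maxCovered H (S \ W) + 2 * (univ.filter fun c : Quotient (missedSetoid H S hD) =>
      2 ≤ (W.filter fun v => Quotient.mk _ v = c).card).card ≤ maxCovered H S := by
  obtain ⟨f, hf⟩ := exists_isMaxMatchingInvolution H S
  obtain ⟨g, hg, hgc⟩ := exists_isMaxMatchingInvolution H (S \ W)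
  have hg' : IsMatchingInvolution H S g := hg.mono Finset.sdiff_subset
  rw [← hf.2, ← hgc,
    Finset.card_eq_sum_card_fiberwise (f := Quotient.mk (missedSetoid H S hD)) (s := covered f)
      (t := univ) (fun _ _ => by simp),
    Finset.card_eq_sum_card_fiberwise (f := Quotient.mk (missedSetoid H S hD)) (s := covered g)
      (t := univ) (fun _ _ => by simp), Finset.card_filter, Finset.mul_sum,
    ← Finset.sum_add_distrib]
  refine Finset.sum_le_sum fun c _ => ?_
  have h1 := card_class_le hD hf c
  obtain ⟨a, ha⟩ := even_card_covered_class hD hf.1 c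
  obtain ⟨b, hb⟩ := even_card_covered_class hD hg' c
  have h2 : ((covered g).filter fun v => Quotient.mk (missedSetoid H S hD) v = c).card +
      (W.filter fun v => Quotient.mk (missedSetoid H S hD) v = c).card ≤
      (univ.filter fun v => Quotient.mk (missedSetoid H S hD) v = c).card := by
    rw [← Finset.card_union_of_disjoint]
    · refine Finset.card_le_card fun v hv => ?_
      simp only [Finset.mem_union, Finset.mem_filter, Finset.mem_univ, true_and] at hv ⊢
      tauto
    · refine Finset.disjoint_left.2 fun v hv hw => ?_
      have h := (hg.2 v (mem_covered.1 (Finset.mem_filter.1 hv).1)).1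
      exact (Finset.mem_sdiff.1 h).2 (Finset.mem_filter.1 hw).1
  split_ifs <;> omega

end Classes

/-- Deleting an essential vertex lowers the matching number. -/
lemma maxCovered_sdiff_singleton_add_le {H : SimpleGraph V} {S : Finset V} {v : V}
    (hv : ∀ f, IsMaxMatchingInvolution H S f → f v ≠ v) :
    maxCovered H (S \ {v}) + 2 ≤ maxCovered H S := by
  obtain ⟨g, hg, hgc⟩ := exists_isMaxMatchingInvolution H (S \ {v})
  have hg' : IsMatchingInvolution H S g := hg.mono Finset.sdiff_subset
  have hgv : g v = v := by_contra fun h => by simpa using (hg.2 v h).1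
  have hne : (covered g).card ≠ maxCovered H S := fun h => hv g ⟨hg', h⟩ hgv
  have hle := hg'.card_le
  obtain ⟨a, ha⟩ := hg'.even_card
  obtain ⟨b, hb⟩ := even_maxCovered H S
  omega

end Involutions

/-- The graph joining distinct vertices that are equivalent for one of the relations `r j`. -/
def sharedGraph {ι : Type*} (r : ι → Setoid V) : SimpleGraph V where
  Adj u v := u ≠ v ∧ ∃ j, r j u v
  symm := ⟨fun _ _ ⟨h, j, hj⟩ => ⟨h.symm, j, (r j).symm hj⟩⟩
  loopless := ⟨fun _ h => h.1 rfl⟩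

/-- The graph `H` without the edges inside `U`. -/
def outerGraph (H : SimpleGraph V) (U : Set V) : SimpleGraph V where
  Adj u v := H.Adj u v ∧ ¬ (u ∈ U ∧ v ∈ U)
  symm := ⟨fun _ _ ⟨h, h'⟩ => ⟨h.symm, fun h'' => h' h''.symm⟩⟩
  loopless := ⟨fun _ h => H.loopless.irrefl _ h.1⟩

/-- No two vertices of `U` are connected through the outside of `U`. -/
def IsOuterSeparated (H : SimpleGraph V) (U : Set V) : Prop :=
  ∀ x ∈ U, ∀ y ∈ U, (outerGraph H U).Reachable x y → x = y

lemma outerGraph_anti (H : SimpleGraph V) {U U' : Set V} (h : U ⊆ U') :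
    outerGraph H U' ≤ outerGraph H U :=
  fun _ _ hab => ⟨hab.1, fun h' => hab.2 ⟨h h'.1, h h'.2⟩⟩

/-- Adding to an outer separated set `U` an outer separated clique meeting it. -/
lemma IsOuterSeparated.union {H : SimpleGraph V} {U L : Set V} (hU : IsOuterSeparated H U)
    (hL : IsOuterSeparated H L) (hclique : ∀ x ∈ L, ∀ y ∈ L, x ≠ y → H.Adj x y) {u : V}
    (huU : u ∈ U) (huL : u ∈ L) : IsOuterSeparated H (U ∪ L) := by
  have mixed : ∀ x ∈ U, x ∉ L → ∀ y ∈ L, y ∉ U → ¬ (outerGraph H (U ∪ L)).Reachable x y := by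
    intro x hx hxL y hy hyU hxy
    have h1 := hxy.mono (outerGraph_anti H Set.subset_union_left)
    have h2 : (outerGraph H U).Adj y u :=
      ⟨hclique y hy u huL fun h => hyU (h ▸ huU), fun h => hyU h.1⟩
    exact hxL (hU x hx u huU (h1.trans h2.reachable) ▸ huL)
  intro x hx y hy hxy
  by_cases hxU : x ∈ U <;> by_cases hyU : y ∈ U
  · exact hU x hxU y hyU (hxy.mono (outerGraph_anti H Set.subset_union_left))
  · have hyL := hy.resolve_left hyU
    by_cases hxL : x ∈ L
    · exact hL x hxL y hyL (hxy.mono (outerGraph_anti H Set.subset_union_right))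
    · exact absurd hxy (mixed x hxU hxL y hyL hyU)
  · have hxL := hx.resolve_left hxU
    by_cases hyL : y ∈ L
    · exact hL x hxL y hyL (hxy.mono (outerGraph_anti H Set.subset_union_right))
    · exact absurd hxy.symm (mixed y hyU hyL x hxL hxU)
  · exact hL x (hx.resolve_left hxU) y (hy.resolve_left hyU)
      (hxy.mono (outerGraph_anti H Set.subset_union_right))

/-- Adding one vertex to a set without outgoing edges gives an outer separated set. -/
lemma isOuterSeparated_insert {H : SimpleGraph V} {U : Set V}
    (hout : ∀ x ∈ U, ∀ y ∉ U, ¬ H.Adj x y) (c : V) : IsOuterSeparated H (insert c U) := by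
  have isolated : ∀ x ∈ U, ∀ y, (outerGraph H (insert c U)).Reachable x y → x = y := by
    rintro x hx y ⟨p⟩
    cases p with
    | nil => rfl
    | @cons _ w _ h _ =>
      exact absurd h.1 (hout x hx w fun hw => h.2 ⟨Or.inr hx, Or.inr hw⟩)
  rintro x (rfl | hx) y (rfl | hy) hxy
  · rfl
  · exact (isolated y hy x hxy.symm).symm
  · exact isolated x hx y hxy
  · exact isolated x hx y hxy

section Hyperforest

open Finset
open scoped Classical

/-- A large set split into classes with no edges of a connector in between has a class of
size at least `s`. -/
lemma exists_large_class {β : Type*} {s : ℕ} {A : Finset V} (φ : V → β)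
    (hconn : ∀ X ⊆ A, ∀ Y ⊆ A, s ≤ X.card → s ≤ Y.card → ∃ x ∈ X, ∃ y ∈ Y, φ x = φ y)
    (hA : 3 * s ≤ A.card + 2) (hs : 1 ≤ s) :
    ∃ b, s ≤ (A.filter fun v => φ v = b).card := by
  by_contra! hsmall
  obtain ⟨B, hB, hmin⟩ := Finset.exists_min_image
    ((A.image φ).powerset.filter fun B => s ≤ (A.filter fun v => φ v ∈ B).card)
    Finset.card ⟨A.image φ, by
      simp only [Finset.mem_filter, Finset.mem_powerset, Finset.Subset.refl, true_and]
      rw [Finset.filter_true_of_mem fun v hv => Finset.mem_image_of_mem φ hv]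
      omega⟩
  simp only [Finset.mem_filter, Finset.mem_powerset] at hB hmin
  obtain ⟨b, hb⟩ : B.Nonempty := by
    rw [Finset.nonempty_iff_ne_empty]
    rintro rfl
    simp at hB
    omega
  have herase : (A.filter fun v => φ v ∈ B.erase b).card < s := by
    by_contra! h
    have := hmin (B.erase b) ⟨(Finset.erase_subset _ _).trans hB.1, h⟩
    exact absurd (Finset.card_erase_lt_of_mem hb) (not_lt.2 this)
  have hle : (A.filter fun v => φ v ∈ B).card ≤
      (A.filter fun v => φ v ∈ B.erase b).card + (A.filter fun v => φ v = b).card := by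
    refine (Finset.card_le_card fun v hv => ?_).trans (Finset.card_union_le _ _)
    simp only [Finset.mem_union, Finset.mem_filter, Finset.mem_erase] at hv ⊢
    tauto
  have hsplit := Finset.card_filter_add_card_filter_not (s := A) (fun v => φ v ∈ B)
  have hb' := hsmall b
  obtain ⟨x, hx, y, hy, hxy⟩ := hconn (A.filter fun v => φ v ∈ B) (Finset.filter_subset _ _)
    (A.filter fun v => ¬ φ v ∈ B) (Finset.filter_subset _ _) hB.2 (by omega)
  rw [Finset.mem_filter] at hx hy
  exact hy.2 (hxy ▸ hx.2)

/-- In a connector, an outer separated set is either small or almost everything. -/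
lemma IsOuterSeparated.card_sdiff_le {H : SimpleGraph V} {s : ℕ} {S U : Finset V}
    (hU : IsOuterSeparated H (U : Set V)) (hs : 1 ≤ s)
    (hconn : ∀ X ⊆ S, ∀ Y ⊆ S, Disjoint X Y → s ≤ X.card → s ≤ Y.card →
      ∃ x ∈ X, ∃ y ∈ Y, H.Adj x y)
    (hUS : U ⊆ S) (hcard : s < U.card) : (S \ U).card ≤ 3 * (s - 1) := by
  by_contra! hbig
  have hreach : ∀ x y, x ∉ U → H.Adj x y → (outerGraph H U).connectedComponentMk x =
      (outerGraph H U).connectedComponentMk y := fun x y hx h =>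
    ConnectedComponent.sound (SimpleGraph.Adj.reachable ⟨h, fun h' => hx h'.1⟩)
  obtain ⟨b, hb⟩ := exists_large_class (A := S \ U) (s := s) (outerGraph H U).connectedComponentMk
    (by
      intro X hX Y hY hXs hYs
      by_cases hd : Disjoint X Y
      · obtain ⟨x, hx, y, hy, h⟩ := hconn X (hX.trans Finset.sdiff_subset) Y
          (hY.trans Finset.sdiff_subset) hd hXs hYs
        exact ⟨x, hx, y, hy, hreach x y (Finset.mem_sdiff.1 (hX hx)).2 h⟩
      · obtain ⟨x, hx, hy⟩ := Finset.not_disjoint_iff.1 hd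
        exact ⟨x, hx, x, hy, rfl⟩) (by omega) hs
  have hone : (U.filter fun v => (outerGraph H U).connectedComponentMk v = b).card ≤ 1 := by
    refine Finset.card_le_one.2 fun u hu v hv => ?_
    rw [Finset.mem_filter] at hu hv
    exact hU u hu.1 v hv.1 (ConnectedComponent.exact (hu.2.trans hv.2.symm))
  have hsplit := Finset.card_filter_add_card_filter_not (s := U)
    (fun v => (outerGraph H U).connectedComponentMk v = b)
  obtain ⟨x, hx, y, hy, h⟩ := hconn
    ((S \ U).filter fun v => (outerGraph H U).connectedComponentMk v = b)
    ((Finset.filter_subset _ _).trans Finset.sdiff_subset)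
    (U.filter fun v => ¬ (outerGraph H U).connectedComponentMk v = b)
    ((Finset.filter_subset _ _).trans hUS)
    (Finset.disjoint_left.2 fun v hv hv' => by
      rw [Finset.mem_filter, Finset.mem_sdiff] at hv
      exact hv.1.2 (Finset.mem_filter.1 hv').1)
    hb (by omega)
  rw [Finset.mem_filter] at hx hy
  exact hy.2 ((hreach x y (Finset.mem_sdiff.1 hx.1).2 h).symm.trans hx.2)

variable [Fintype V] {ι : Type*} [Fintype ι]

/-- If the classes of the relations `r j` form a hyperforest on `S`, in the sense that every
nonempty `W ⊆ S` has more vertices than there are classes meeting it twice, then each class is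
outer separated. -/
lemma isOuterSeparated_class (r : ι → Setoid V) {S : Finset V}
    (hS : ∀ j u v, r j u v → u ≠ v → u ∈ S)
    (hforest : ∀ W ⊆ S, W.Nonempty → (univ.filter fun p : Σ j, Quotient (r j) =>
      2 ≤ (W.filter fun v => Quotient.mk (r p.1) v = p.2).card).card < W.card)
    (j₀ : ι) (a : V) : IsOuterSeparated (sharedGraph r) {v | r j₀ a v} := by
  set K : Set V := {v | r j₀ a v} with hK
  set F := outerGraph (sharedGraph r) K with hF
  have two_le : ∀ (W : Finset V) (j : ι) (u v w : V), u ∈ W → v ∈ W → u ≠ v → r j w u → r j w v →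
      2 ≤ (W.filter fun x => Quotient.mk (r j) x = Quotient.mk (r j) w).card := by
    intro W j u v w hu hv huv hwu hwv
    rw [← Finset.card_pair huv]
    refine Finset.card_le_card fun x hx => ?_
    rw [Finset.mem_filter]
    rcases Finset.mem_insert.1 hx with rfl | hx
    · exact ⟨hu, Quotient.sound ((r j).symm hwu)⟩
    · rw [Finset.mem_singleton.1 hx]
      exact ⟨hv, Quotient.sound ((r j).symm hwv)⟩
  by_contra hcon
  have hex : ∃ d, ∃ x ∈ K, ∃ y ∈ K, x ≠ y ∧ ∃ p : F.Walk x y, p.length = d := by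
    unfold IsOuterSeparated at hcon
    push Not at hcon
    obtain ⟨x, hx, y, hy, ⟨p⟩, hxy⟩ := hcon
    exact ⟨_, x, hx, y, hy, hxy, p, rfl⟩
  obtain ⟨x, hx, y, hy, hxy, p, hp⟩ := Nat.find_spec hex
  have hmin : ∀ u ∈ K, ∀ v ∈ K, u ≠ v → ∀ w : F.Walk u v, p.length ≤ w.length :=
    fun u hu v hv huv w => hp ▸ Nat.find_min' hex ⟨u, hu, v, hv, huv, w, rfl⟩
  set d := p.length with hd
  set X := p.getVert with hX
  have hX0 : X 0 = x := p.getVert_zero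
  have hXd : X d = y := p.getVert_length
  have hadj : ∀ i < d, F.Adj (X i) (X (i + 1)) := fun i hi => p.adj_getVert_succ hi
  have hshort : ∀ i k, i ≤ d → k ≤ d → ∀ w : F.Walk (X i) (X k), k ≤ i + w.length := by
    intro i k hi hk w
    have := hmin x hx y hy hxy (((p.take i).append w).append (p.drop k))
    rw [Walk.length_append, Walk.length_append, Walk.take_length, Walk.drop_length] at this
    omega
  have hinj : ∀ i ≤ d, ∀ k ≤ d, X i = X k → i = k := by
    intro i hi k hk h
    have h1 := hshort i k hi hk (Walk.nil.copy rfl h)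
    have h2 := hshort k i hk hi (Walk.nil.copy rfl h.symm)
    rw [Walk.length_copy, Walk.length_nil] at h1 h2
    omega
  have hends : ∀ i k, i < k → k ≤ d → X i ∈ K → X k ∈ K → i = 0 ∧ k = d := by
    intro i k hik hk hi hkK
    have hne : X i ≠ X k := fun h => by have := hinj i (by omega) k hk h; omega
    have h := hmin (X i) hi (X k) hkK hne
      (((p.drop i).take (k - i)).copy rfl (by
        rw [Walk.drop_getVert, hX]
        congr 1
        omega))
    rw [Walk.length_copy, Walk.take_length] at h
    omega
  have hcol : ∀ i, ∃ j, i < d → r j (X i) (X (i + 1)) := by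
    intro i
    by_cases hi : i < d
    · obtain ⟨j, hj⟩ := (hadj i hi).1.2
      exact ⟨j, fun _ => hj⟩
    · exact ⟨j₀, fun h => absurd h hi⟩
  choose col hcol using hcol
  set L : ℕ → Σ j, Quotient (r j) := fun i =>
    if i < d then ⟨col i, Quotient.mk _ (X i)⟩ else ⟨j₀, Quotient.mk _ a⟩ with hL
  have hXS : ∀ i ≤ d, X i ∈ S := by
    intro i hi
    rcases Nat.lt_or_ge i d with h | h
    · exact hS _ _ _ (hcol i h) (hadj i h).1.1
    · obtain rfl : i = d := le_antisymm hi h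
      rw [hXd]
      exact hS j₀ y x ((r j₀).trans ((r j₀).symm hy) hx) hxy.symm
  -- the class of an edge of the walk is not `K`
  have hLK : ∀ i < d, (⟨col i, Quotient.mk _ (X i)⟩ : Σ j, Quotient (r j)) ≠
      ⟨j₀, Quotient.mk _ a⟩ := by
    intro i hi h
    have h1 : col i = j₀ := congrArg Sigma.fst h
    have h2 : r j₀ a (X i) := by
      have : ∀ (j : ι) (u : V), (⟨j, Quotient.mk _ u⟩ : Σ j, Quotient (r j)) =
          ⟨j₀, Quotient.mk _ a⟩ → r j₀ a u := by
        rintro j u hju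
        obtain rfl : j = j₀ := congrArg Sigma.fst hju
        exact (r j).symm (Quotient.exact (eq_of_heq (Sigma.mk.inj hju).2))
      exact this _ _ h
    exact (hadj i hi).2 ⟨h2, (r j₀).trans h2 (h1 ▸ hcol i hi)⟩
  -- two edges of the walk do not lie in the same class
  have hLne : ∀ i k, i < k → k < d → (⟨col i, Quotient.mk _ (X i)⟩ : Σ j, Quotient (r j)) ≠
      ⟨col k, Quotient.mk _ (X k)⟩ := by
    intro i k hik hk h
    have hr : r (col i) (X i) (X (k + 1)) := by
      have : ∀ (j j' : ι) (u u' v : V), (⟨j, Quotient.mk _ u⟩ : Σ j, Quotient (r j)) =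
          ⟨j', Quotient.mk _ u'⟩ → r j' u' v → r j u v := by
        rintro j j' u u' v hju huv
        obtain rfl : j = j' := congrArg Sigma.fst hju
        exact (r j).trans (Quotient.exact (eq_of_heq (Sigma.mk.inj hju).2)) huv
      exact this _ _ _ _ _ h (hcol k hk)
    have hne : X i ≠ X (k + 1) := fun h => by have := hinj i (by omega) (k + 1) hk h; omega
    by_cases hin : X i ∈ K ∧ X (k + 1) ∈ K
    · have hWS : ({X i, X (k + 1)} : Finset V) ⊆ S := by
        intro v hv
        rcases Finset.mem_insert.1 hv with rfl | hv
        · exact hXS i (by omega)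
        · rw [Finset.mem_singleton.1 hv]
          exact hXS (k + 1) hk
      have hlt := hforest _ hWS (Finset.insert_nonempty _ _)
      rw [Finset.card_pair hne] at hlt
      have hsub : ({⟨col i, Quotient.mk _ (X i)⟩, ⟨j₀, Quotient.mk _ a⟩} :
          Finset (Σ j, Quotient (r j))) ⊆ univ.filter fun p : Σ j, Quotient (r j) =>
          2 ≤ (({X i, X (k + 1)} : Finset V).filter fun v => Quotient.mk (r p.1) v = p.2).card := by
        intro q hq
        rw [Finset.mem_filter]
        refine ⟨Finset.mem_univ _, ?_⟩
        rcases Finset.mem_insert.1 hq with rfl | hq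
        · exact two_le _ _ _ _ _ (by simp) (by simp) hne ((r _).refl _) hr
        · rw [Finset.mem_singleton.1 hq]
          exact two_le _ _ _ _ _ (by simp) (by simp) hne hin.1 hin.2
      have := Finset.card_le_card hsub
      rw [Finset.card_pair (hLK i (by omega))] at this
      omega
    · have h1 : F.Adj (X i) (X (k + 1)) := ⟨⟨hne, _, hr⟩, hin⟩
      have := hshort i (k + 1) (by omega) hk h1.toWalk
      rw [Walk.length_cons, Walk.length_nil] at this
      omega
  set W := (Finset.range (d + 1)).image X with hW
  have hWcard : W.card = d + 1 := by
    rw [hW, Finset.card_image_of_injOn, Finset.card_range]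
    intro i hi k hk h
    simp only [Finset.coe_range, Set.mem_Iio] at hi hk
    exact hinj i (by omega) k (by omega) h
  have hWmem : ∀ i ≤ d, X i ∈ W := fun i hi =>
    Finset.mem_image_of_mem _ (Finset.mem_range.2 (by omega))
  have hWS : W ⊆ S := by
    intro v hv
    obtain ⟨i, hi, rfl⟩ := Finset.mem_image.1 hv
    rw [Finset.mem_range] at hi
    exact hXS i (by omega)
  have hlt := hforest W hWS ⟨_, hWmem 0 (by omega)⟩
  have hLinj : Set.InjOn L (Finset.range (d + 1)) := by
    have aux : ∀ i k, i < k → k ≤ d → L i ≠ L k := by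
      intro i k hik hk
      simp only [hL, if_pos (show i < d by omega)]
      split_ifs with h
      · exact hLne i k hik h
      · exact hLK i (by omega)
    intro i hi k hk h
    simp only [Finset.coe_range, Set.mem_Iio] at hi hk
    rcases lt_trichotomy i k with hlt | rfl | hlt
    · exact absurd h (aux i k hlt (by omega))
    · rfl
    · exact absurd h.symm (aux k i hlt (by omega))
  have hsub : (Finset.range (d + 1)).image L ⊆ univ.filter fun p : Σ j, Quotient (r j) =>
      2 ≤ (W.filter fun v => Quotient.mk (r p.1) v = p.2).card := by
    intro q hq
    obtain ⟨i, -, rfl⟩ := Finset.mem_image.1 hq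
    rw [Finset.mem_filter]
    refine ⟨Finset.mem_univ _, ?_⟩
    by_cases h : i < d
    · rw [show L i = ⟨col i, Quotient.mk _ (X i)⟩ from if_pos h]
      exact two_le _ _ _ _ _ (hWmem i h.le) (hWmem (i + 1) h) (hadj i h).1.1 ((r _).refl _)
        (hcol i h)
    · rw [show L i = ⟨j₀, Quotient.mk _ a⟩ from if_neg h]
      exact two_le _ _ _ _ _ (hX0 ▸ hWmem 0 (by omega)) (hXd ▸ hWmem d le_rfl) hxy hx hy
  have := Finset.card_le_card hsub
  rw [Finset.card_image_of_injOn hLinj, Finset.card_range] at this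
  omega

/-- A connector whose edges are covered by the classes of a hyperforest is almost contained in a
single class. -/
lemma exists_class_card_ge (r : ι → Setoid V) {S : Finset V} {s : ℕ} (hs : 1 ≤ s)
    (hS : ∀ j u v, r j u v → u ≠ v → u ∈ S)
    (hforest : ∀ W ⊆ S, W.Nonempty → (univ.filter fun p : Σ j, Quotient (r j) =>
      2 ≤ (W.filter fun v => Quotient.mk (r p.1) v = p.2).card).card < W.card)
    (hconn : ∀ X ⊆ S, ∀ Y ⊆ S, Disjoint X Y → s ≤ X.card → s ≤ Y.card →
      ∃ x ∈ X, ∃ y ∈ Y, (sharedGraph r).Adj x y)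
    (hcard : 2 * s ≤ S.card) :
    ∃ j a, S.card ≤ (univ.filter fun v => Quotient.mk (r j) v = Quotient.mk (r j) a).card
      + 4 * (s - 1) := by
  obtain ⟨U, hU, hmax⟩ := Finset.exists_max_image
    (S.powerset.filter fun U : Finset V => IsOuterSeparated (sharedGraph r) (U : Set V) ∧ U.card ≤ s)
    Finset.card ⟨∅, by simp [IsOuterSeparated]⟩
  simp only [Finset.mem_filter, Finset.mem_powerset] at hU hmax
  obtain ⟨hUS, hUsep, hUs⟩ := hU
  have hsd := Finset.card_sdiff_add_card_eq_card hUS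
  obtain ⟨u, hu, c, hc, hadj⟩ : ∃ u ∈ U, ∃ c ∉ U, (sharedGraph r).Adj u c := by
    by_contra! hno
    have hlt : U.card < s := by
      by_contra! h
      obtain ⟨x, hx, y, hy, hxy⟩ := hconn U hUS (S \ U) Finset.sdiff_subset
        Finset.disjoint_sdiff h (by omega)
      exact hno x hx y (Finset.mem_sdiff.1 hy).2 hxy
    obtain ⟨c, hc⟩ : (S \ U).Nonempty := Finset.card_pos.1 (by omega)
    rw [Finset.mem_sdiff] at hc
    have := hmax (insert c U) ⟨Finset.insert_subset hc.1 hUS, by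
      rw [Finset.coe_insert]
      exact isOuterSeparated_insert (fun x hx y hy => hno x hx y hy) c, by
      rw [Finset.card_insert_of_notMem hc.2]; omega⟩
    rw [Finset.card_insert_of_notMem hc.2] at this
    omega
  obtain ⟨huc, j, hj⟩ := hadj
  set L := univ.filter fun v => Quotient.mk (r j) v = Quotient.mk (r j) u with hL
  have hmemL : ∀ v, v ∈ L ↔ r j u v := by
    intro v
    rw [hL, Finset.mem_filter]
    exact ⟨fun h => (r j).symm (Quotient.exact h.2),
      fun h => ⟨Finset.mem_univ _, Quotient.sound ((r j).symm h)⟩⟩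
  have hLset : (L : Set V) = {v | r j u v} := by
    ext v
    exact hmemL v
  have hLS : L ⊆ S := by
    intro v hv
    by_cases h : v = u
    · exact h ▸ hUS hu
    · exact hS j v u ((r j).symm ((hmemL v).1 hv)) h
  have hsep : IsOuterSeparated (sharedGraph r) ((U ∪ L : Finset V) : Set V) := by
    rw [Finset.coe_union, hLset]
    refine hUsep.union (isOuterSeparated_class r hS hforest j u) ?_ (u := u) hu ((r j).refl u)
    exact fun x hx y hy hxy => ⟨hxy, j, (r j).trans ((r j).symm hx) hy⟩
  have hUL : U ∪ L ⊆ S := Finset.union_subset hUS hLS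
  have hss : U.card < (U ∪ L).card :=
    Finset.card_lt_card (Finset.ssubset_iff_subset_ne.2 ⟨Finset.subset_union_left, fun h =>
      hc (h ▸ Finset.mem_union_right _ ((hmemL c).2 hj))⟩)
  have hgt : s < (U ∪ L).card := by
    by_contra! h
    exact absurd (hmax _ ⟨hUL, hsep, h⟩) (not_le.2 hss)
  have h1 := hsep.card_sdiff_le hs hconn hUL hgt
  have h2 := Finset.card_sdiff_add_card_eq_card hUL
  have h3 := Finset.card_union_add_card_inter U L
  have h4 : 0 < (U ∩ L).card :=
    Finset.card_pos.2 ⟨u, Finset.mem_inter.2 ⟨hu, (hmemL u).2 ((r j).refl u)⟩⟩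
  have h5 : S.card ≤ L.card + 4 * (s - 1) := by omega
  exact ⟨j, u, h5⟩

end Hyperforest

open scoped Classical in
/-- Restricting to a suitable vertex set `S` makes every deletion inefficient: removing `W` costs
strictly less than `|W|` in the sum of the matching numbers. -/
lemma exists_deletion_minimal [Fintype V] {ι : Type*} [Fintype ι] (Gc : ι → SimpleGraph V) :
    ∃ S : Finset V, ∑ j, maxCovered (Gc j) S + 2 * (Fintype.card V - S.card) ≤
        ∑ j, maxCovered (Gc j) Finset.univ ∧
      ∀ W ⊆ S, W.Nonempty →
        ∑ j, maxCovered (Gc j) S < ∑ j, maxCovered (Gc j) (S \ W) + 2 * W.card := by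
  obtain ⟨S, hS, hmin⟩ := Finset.exists_min_image
    (Finset.univ.filter fun S : Finset V =>
      ∑ j, maxCovered (Gc j) S + 2 * (Fintype.card V - S.card) ≤
        ∑ j, maxCovered (Gc j) Finset.univ)
    Finset.card ⟨Finset.univ, by simp⟩
  simp only [Finset.mem_filter, Finset.mem_univ, true_and] at hS hmin
  refine ⟨S, hS, fun W hW hne => ?_⟩
  by_contra! hcon
  have h1 := Finset.card_sdiff_add_card_eq_card hW
  have h2 := hne.card_pos
  have h3 := Finset.card_le_univ S
  have := hmin (S \ W) (by omega)
  omega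

open scoped Classical in
/-- If every deletion from `S` is inefficient, then a connector covered by the graphs `Gc j` is
small on `S`, or some `Gc j` has a matching covering almost all of `S`. -/
lemma exists_card_le_maxCovered [Fintype V] {ι : Type*} [Fintype ι] (Gc : ι → SimpleGraph V)
    {G : SimpleGraph V} {s : ℕ} (hs : 1 ≤ s) (hG : IsConnector G s)
    (hcol : ∀ u v, G.Adj u v → ∃ j, (Gc j).Adj u v) {S : Finset V}
    (hdel : ∀ W ⊆ S, W.Nonempty →
      ∑ j, maxCovered (Gc j) S < ∑ j, maxCovered (Gc j) (S \ W) + 2 * W.card)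
    (hcard : 2 * s ≤ S.card) :
    ∃ j, S.card ≤ maxCovered (Gc j) S + 1 + 4 * (s - 1) := by
  have hD : ∀ j v, ∃ f, IsMaxMatchingInvolution (Gc j) S f ∧ f v = v := by
    intro j v
    by_contra! hess
    by_cases hv : v ∈ S
    · have h1 := hdel {v} (Finset.singleton_subset_iff.2 hv) (Finset.singleton_nonempty v)
      have h2 : ∑ i, maxCovered (Gc i) (S \ {v}) + 2 ≤ ∑ i, maxCovered (Gc i) S := by
        rw [← Finset.add_sum_erase _ _ (Finset.mem_univ j),
          ← Finset.add_sum_erase _ _ (Finset.mem_univ j)]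
        have h3 := maxCovered_sdiff_singleton_add_le hess
        have h4 : ∑ i ∈ Finset.univ.erase j, maxCovered (Gc i) (S \ {v}) ≤
            ∑ i ∈ Finset.univ.erase j, maxCovered (Gc i) S :=
          Finset.sum_le_sum fun i _ => maxCovered_mono _ Finset.sdiff_subset
        omega
      rw [Finset.card_singleton] at h1
      omega
    · obtain ⟨f, hf⟩ := exists_isMaxMatchingInvolution (Gc j) S
      exact hess f hf (by_contra fun h => hv (hf.1.2 v h).1)
  set r : ι → Setoid V := fun j => missedSetoid (Gc j) S (hD j) with hr
  obtain ⟨j, a, h⟩ := exists_class_card_ge r (S := S) hs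
    (fun j u v h huv => mem_of_missedSetoid (hD j) h huv)
    (by
      intro W hW hne
      have h1 := hdel W hW hne
      have h2 : ∑ j, maxCovered (Gc j) (S \ W) + 2 * (Finset.univ.filter
          fun p : Σ j, Quotient (r j) =>
            2 ≤ (W.filter fun v => Quotient.mk (r p.1) v = p.2).card).card ≤
          ∑ j, maxCovered (Gc j) S := by
        rw [Finset.card_filter, Fintype.sum_sigma, Finset.mul_sum, ← Finset.sum_add_distrib]
        refine Finset.sum_le_sum fun j _ => ?_
        rw [← Finset.card_filter]
        exact maxCovered_sdiff_add_le (hD j) W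
      omega)
    (by
      intro X hX Y hY hXY hXs hYs
      obtain ⟨x, hx, y, hy, hxy⟩ := hG X Y (Finset.disjoint_coe.2 hXY)
        (by rwa [Set.ncard_coe_finset]) (by rwa [Set.ncard_coe_finset])
      obtain ⟨j, hj⟩ := hcol x y hxy
      exact ⟨x, hx, y, hy, hxy.ne, j, missedSetoid_of_adj (hD j) (hX hx) (hY hy) hj⟩)
    hcard
  have := card_class_le_maxCovered (hD j) (Quotient.mk _ a)
  refine ⟨j, h.trans (Nat.add_le_add_right ?_ _)⟩
  exact this

/-- **Lemma 3.9 (Distilling).** Let `G` be an `s`-connector and `𝒢 = (G₀, G₁, …, G_q)` a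
fully-coloured `q`-multicolouring of `G` with `ν(G_j) ≤ |V|/2 - s` for all colours `j`.
Then there exist `T ⊆ V`, a colour `η` and an integer `κ` with
(1) `2κ + 1 ≥ |V| - |T| - (q+13)(s-1)`; (2) `ν(G_η) ≥ κ`; (3) `∑_j ν(G_j) ≥ κ + |T|`. -/
theorem distilling {V : Type*} [Fintype V] {q s : ℕ} (hq : 1 ≤ q) (hs : 1 ≤ s)
    (G G0 : SimpleGraph V)
    (Gc : Fin q → SimpleGraph V) (hcol : IsMulticolouring G G0 Gc) (hfull : G0 = ⊥)
    (hG : IsConnector G s)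
    (hnu : ∀ j, (matchingNumber (Gc j) : ℝ) ≤ (Fintype.card V : ℝ) / 2 - s) :
    ∃ (T : Set V) (η : Fin q) (κ : ℤ),
      ((Fintype.card V : ℤ) - (T.ncard : ℤ) - (q + 13) * (s - 1) ≤ 2 * κ + 1) ∧
      (κ ≤ (matchingNumber (Gc η) : ℤ)) ∧
      (κ + (T.ncard : ℤ) ≤ ∑ j, (matchingNumber (Gc j) : ℤ)) := by
  classical
  obtain ⟨S, hS, hdel⟩ := exists_deletion_minimal Gc
  have hadj : ∀ u v, G.Adj u v → ∃ j, (Gc j).Adj u v := by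
    intro u v h
    rw [← show G0 ⊔ (⨆ j, Gc j) = G from hcol, hfull, bot_sup_eq, SimpleGraph.iSup_adj] at h
    exact h
  have hmain : ∃ η, S.card ≤ maxCovered (Gc η) S + 1 + 4 * (s - 1) := by
    by_cases hcard : 2 * s ≤ S.card
    · exact exists_card_le_maxCovered Gc hs hG hadj hdel hcard
    · exact ⟨⟨0, hq⟩, by omega⟩
  obtain ⟨η, hη⟩ := hmain
  obtain ⟨κ, hκ⟩ := even_maxCovered (Gc η) S
  have hT : ((Sᶜ : Finset V) : Set V).ncard = Fintype.card V - S.card := by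
    rw [Set.ncard_coe_finset, Finset.card_compl]
  have hSle := Finset.card_le_univ S
  refine ⟨((Sᶜ : Finset V) : Set V), η, κ, ?_, ?_, ?_⟩
  · obtain ⟨t, rfl⟩ : ∃ t, s = t + 1 := ⟨s - 1, by omega⟩
    rw [hT]
    push_cast [hSle]
    have h0 : (0 : ℤ) ≤ q * t := by positivity
    have h1 : (S.card : ℤ) ≤ 2 * κ + 1 + 4 * t := by
      have : S.card ≤ 2 * κ + 1 + 4 * t := by omega
      exact_mod_cast this
    linarith
  · have := maxCovered_le_two_mul_matchingNumber (Gc η) S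
    exact_mod_cast (by omega : κ ≤ matchingNumber (Gc η))
  · have h1 : ∑ j, maxCovered (Gc j) Finset.univ ≤ 2 * ∑ j, matchingNumber (Gc j) := by
      rw [Finset.mul_sum]
      exact Finset.sum_le_sum fun j _ => maxCovered_le_two_mul_matchingNumber (Gc j) _
    have h2 := Finset.single_le_sum (f := fun j => maxCovered (Gc j) S)
      (fun _ _ => Nat.zero_le _) (Finset.mem_univ η)
    rw [hT]
    exact_mod_cast (by omega : κ + (Fintype.card V - S.card) ≤ ∑ j, matchingNumber (Gc j))
end

section
/- If G is a finite bipartite graph, then for every integer q ≥ 1 and every t = (t_1,…,t_q) ∈ ℕ_+^q with Λ_t ≥ ν(G), we have G ↛ tK_2; that is, there exists a colouring c : E(G) → {1,…,q} such that for every j ∈ {1,…,q} there is no matching of size t_j all of whose edges have colour j. -/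
open SimpleGraph

variable {V : Type*}

/-- In a finite graph every matching has size at most the matching number. -/
theorem IsMatchingSet.card_le_matchingNumber {V : Type*} [Fintype V] {G : SimpleGraph V}
    {M : Finset (Sym2 V)} (hM : IsMatchingSet G M) : M.card ≤ matchingNumber G := by
  classical
  refine le_csSup ⟨Fintype.card (Sym2 V), ?_⟩ ⟨M, hM, rfl⟩
  rintro n ⟨N, -, rfl⟩
  exact N.card_le_univ

/-- In a vertex cover of minimum size, an independent subset has at least as many
neighbours outside the cover as it has elements. -/
theorem card_le_card_neighbors_sdiff_of_minimum_cover {V : Type*} [DecidableEq V]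
    {G : SimpleGraph V} {C S : Finset V} {N : V → Finset V}
    (hN : ∀ v w, w ∈ N v ↔ G.Adj v w ∧ w ∉ C)
    (hC : ∀ a b, G.Adj a b → a ∈ C ∨ b ∈ C)
    (hmin : ∀ C' : Finset V, (∀ a b, G.Adj a b → a ∈ C' ∨ b ∈ C') → C.card ≤ C'.card)
    (hSC : S ⊆ C) (hS : ∀ a ∈ S, ∀ b ∈ S, ¬ G.Adj a b) :
    S.card ≤ (S.biUnion N).card := by
  have hcover : ∀ a b, G.Adj a b →
      a ∈ (C \ S) ∪ S.biUnion N ∨ b ∈ (C \ S) ∪ S.biUnion N := by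
    intro a b hab
    have hba := hab.symm
    simp only [Finset.mem_union, Finset.mem_sdiff, Finset.mem_biUnion, hN]
    by_cases ha : a ∈ S
    · have hb : b ∉ S := fun hb => hS a ha b hb hab
      by_cases hbC : b ∈ C
      · exact .inr (.inl ⟨hbC, hb⟩)
      · exact .inr (.inr ⟨a, ha, hab, hbC⟩)
    · by_cases haC : a ∈ C
      · exact .inl (.inl ⟨haC, ha⟩)
      · have hbC := (hC a b hab).resolve_left haC
        by_cases hb : b ∈ S
        · exact .inl (.inr ⟨b, hb, hba, haC⟩)
        · exact .inr (.inl ⟨hbC, hb⟩)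
  have h₁ := hmin _ hcover
  have h₂ := Finset.card_union_le (C \ S) (S.biUnion N)
  have h₃ := Finset.card_sdiff_add_card_eq_card hSC
  omega

/-- **Kőnig's theorem**: a finite bipartite graph has a vertex cover whose size is at most
the matching number. -/
theorem exists_cover_card_le_matchingNumber {V : Type*} [Fintype V] (G : SimpleGraph V)
    (X : Set V) (hbip : ∀ a b, G.Adj a b → (a ∈ X ↔ b ∉ X)) :
    ∃ C : Finset V, (∀ a b, G.Adj a b → a ∈ C ∨ b ∈ C) ∧ C.card ≤ matchingNumber G := by
  classical
  obtain ⟨C, hC, hmin⟩ := Set.exists_min_image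
    {C : Finset V | ∀ a b, G.Adj a b → a ∈ C ∨ b ∈ C} Finset.card (Set.toFinite _)
    ⟨Finset.univ, fun a b _ => .inl (Finset.mem_univ a)⟩
  simp only [Set.mem_ofPred_eq] at hC hmin
  refine ⟨C, hC, ?_⟩
  let N : V → Finset V := fun v => {w | G.Adj v w ∧ w ∉ C}
  have hN : ∀ v w, w ∈ N v ↔ G.Adj v w ∧ w ∉ C := fun v w => by simp [N]
  have hsubset : ∀ S ⊆ C, S.card ≤ (S.biUnion N).card := by
    intro S hS
    have hX := card_le_card_neighbors_sdiff_of_minimum_cover (S := S.filter (· ∈ X)) hN hC hmin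
      ((Finset.filter_subset _ _).trans hS) fun a ha b hb hab =>
        (hbip a b hab).1 (Finset.mem_filter.1 ha).2 (Finset.mem_filter.1 hb).2
    have hY := card_le_card_neighbors_sdiff_of_minimum_cover (S := S.filter (· ∉ X)) hN hC hmin
      ((Finset.filter_subset _ _).trans hS) fun a ha b hb hab =>
        (Finset.mem_filter.1 ha).2 ((hbip a b hab).2 (Finset.mem_filter.1 hb).2)
    have hdisj : Disjoint ((S.filter (· ∈ X)).biUnion N) ((S.filter (· ∉ X)).biUnion N) := by
      rw [Finset.disjoint_left]
      intro w hw hw'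
      simp only [Finset.mem_biUnion, Finset.mem_filter, hN] at hw hw'
      obtain ⟨a, ⟨-, ha⟩, haw, -⟩ := hw
      obtain ⟨b, ⟨-, hb⟩, hbw, -⟩ := hw'
      exact hb ((hbip b w hbw).2 ((hbip a w haw).1 ha))
    rw [← Finset.card_filter_add_card_filter_not (s := S) (· ∈ X)]
    calc _ ≤ _ := add_le_add hX hY
      _ = _ := (Finset.card_union_of_disjoint hdisj).symm
      _ ≤ _ := Finset.card_le_card <| Finset.union_subset
        (Finset.biUnion_subset_biUnion_of_subset_left _ (Finset.filter_subset _ _))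
        (Finset.biUnion_subset_biUnion_of_subset_left _ (Finset.filter_subset _ _))
  obtain ⟨f, hf, hfN⟩ := (Finset.all_card_le_biUnion_card_iff_exists_injective
    (fun v : C => N v)).1 fun S => by
      have h := hsubset (S.map (Function.Embedding.subtype _)) fun v hv => by
        obtain ⟨w, -, rfl⟩ := Finset.mem_map.1 hv
        exact w.2
      rwa [Finset.card_map, Finset.map_eq_image, Finset.image_biUnion] at h
  simp only [hN] at hfN
  have hne : ∀ v w : C, (v : V) ≠ f w := fun v w h => (hfN w).2 (h ▸ v.2)
  have hinj : Function.Injective fun v : C => s((v : V), f v) := by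
    intro v w h
    rcases Sym2.eq_iff.1 h with h | h
    · exact Subtype.ext h.1
    · exact absurd h.1 (hne v w)
  have hM : IsMatchingSet G (Finset.univ.image fun v : C => s((v : V), f v)) := by
    constructor
    · intro e he
      obtain ⟨v, -, rfl⟩ := Finset.mem_image.1 he
      exact (hfN v).1
    · intro e he e' he' hee' x hx hx'
      obtain ⟨v, -, rfl⟩ := Finset.mem_image.1 he
      obtain ⟨w, -, rfl⟩ := Finset.mem_image.1 he'
      have hvw : v ≠ w := fun h => hee' (by rw [h])
      rcases Sym2.mem_iff.1 hx with rfl | rfl <;> rcases Sym2.mem_iff.1 hx' with h | h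
      · exact hvw (Subtype.ext h)
      · exact hne v w h
      · exact hne w v h.symm
      · exact hvw (hf h)
  simpa [Finset.card_image_of_injective _ hinj] using hM.card_le_matchingNumber

/-- A graph with a vertex cover of size at most `∑ j, (t j - 1)` does not arrow `t`. -/
theorem not_arrowsMatch_of_cover {V : Type*} (G : SimpleGraph V) {q : ℕ} (hq : 1 ≤ q)
    (t : Fin q → ℕ) (ht : ∀ j, 1 ≤ t j) (C : Finset V)
    (hC : ∀ a b, G.Adj a b → a ∈ C ∨ b ∈ C) (hcard : C.card ≤ ∑ j, (t j - 1)) :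
    ¬ ArrowsMatch G t := by
  classical
  obtain ⟨φ⟩ : Nonempty (C ↪ Σ j : Fin q, Fin (t j - 1)) :=
    Function.Embedding.nonempty_of_card_le (by simpa using hcard)
  intro hG
  obtain ⟨j, M, hM, hMt, hMc⟩ := hG fun e =>
    if h : ∃ v : C, (v : V) ∈ e then (φ h.choose).1 else ⟨0, hq⟩
  have hrep : ∀ e : M, ∃ v : C, (v : V) ∈ (e : Sym2 V) ∧ (φ v).1 = j := by
    rintro ⟨e, he⟩
    have h : ∃ v : C, (v : V) ∈ e := by
      have heG := hM.1 e he
      induction e using Sym2.ind with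
      | _ a b =>
        rcases hC a b heG with h | h
        · exact ⟨⟨a, h⟩, Sym2.mem_mk_left a b⟩
        · exact ⟨⟨b, h⟩, Sym2.mem_mk_right a b⟩
    exact ⟨h.choose, h.choose_spec, by simpa only [dif_pos h] using hMc e he⟩
  choose r hr hrj using hrep
  have hlift : ∀ e : M, ∃ i : Fin (t j - 1), φ (r e) = ⟨j, i⟩ := fun e =>
    ⟨hrj e ▸ (φ (r e)).2, by rw [Sigma.ext_iff]; exact ⟨hrj e, by simp⟩⟩
  choose g hg using hlift
  have hginj : Function.Injective g := by
    intro e e' h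
    have hrr : r e = r e' := φ.injective (by rw [hg, hg, h])
    by_contra hne
    exact hM.2 e e.2 e' e'.2 (fun h => hne (Subtype.ext h)) (r e) (hr e) (hrr ▸ hr e')
  have hle := Fintype.card_le_of_injective g hginj
  rw [Fintype.card_coe, Fintype.card_fin] at hle
  have := ht j
  omega

/-- **Proposition 4.2.** If `G` is bipartite (witnessed by a part `X`), `q ≥ 1`, and
`t ∈ ℕ₊^q` satisfies `Λ_t ≥ ν(G)`, then `G ↛ tK₂`. -/
theorem bipartite_not_wCL {V : Type*} [Fintype V] (G : SimpleGraph V)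
    (X : Set V) (hbip : ∀ a b, G.Adj a b → (a ∈ X ↔ b ∉ X))
    {q : ℕ} (hq : 1 ≤ q) (t : Fin q → ℕ) (ht : ∀ j, 1 ≤ t j)
    (hΛ : matchingNumber G ≤ ∑ j, (t j - 1)) :
    ¬ ArrowsMatch G t := by
  obtain ⟨C, hC, hcard⟩ := exists_cover_card_le_matchingNumber G X hbip
  exact not_arrowsMatch_of_cover G hq t ht C hC (hcard.trans hΛ)
end

section
/- Let ℓ = 2k+1 be odd with ℓ ≥ 5 (so k ≥ 2), and let r = ⌊k/2⌋ + 1 and b = ⌈k/2⌉ + 1. Then the cycle C_ℓ satisfies C_ℓ → (r,b)K_2, and Λ_{(r,b)} = r + b − 2 = k = ν(C_ℓ). In particular, C_ℓ is 2-weakly Cockayne–Lorimer: there exists t ∈ ℕ_+^2 with Λ_t ≥ ν(C_ℓ) and C_ℓ → tK_2. -/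
open SimpleGraph

variable {V : Type*}

/-- Twice the size of a matching is at most the number of vertices. -/
theorem IsMatchingSet.two_mul_card_le [Fintype V] {G : SimpleGraph V} {M : Finset (Sym2 V)}
    (hM : IsMatchingSet G M) : 2 * M.card ≤ Fintype.card V := by
  classical
  have hcard : (M.biUnion Sym2.toFinset).card = ∑ e ∈ M, e.toFinset.card := by
    refine Finset.card_biUnion fun e he f hf hef => ?_
    refine Finset.disjoint_left.2 fun v hv hv' => ?_
    rw [Sym2.mem_toFinset] at hv hv'
    exact hM.2 e he f hf hef v hv hv'
  have htwo : ∑ e ∈ M, e.toFinset.card = ∑ _e ∈ M, 2 :=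
    Finset.sum_congr rfl fun e he =>
      Sym2.card_toFinset_of_not_isDiag e (G.not_isDiag_of_mem_edgeSet (hM.1 e he))
  have hle := Finset.card_le_univ (M.biUnion Sym2.toFinset)
  rw [hcard, htwo, Finset.sum_const, smul_eq_mul] at hle
  omega

/-- A subset of a matching is a matching. -/
theorem IsMatchingSet.subset {G : SimpleGraph V} {M N : Finset (Sym2 V)}
    (hM : IsMatchingSet G M) (hN : N ⊆ M) : IsMatchingSet G N :=
  ⟨fun e he => hM.1 e (hN he), fun e he f hf => hM.2 e (hN he) f (hN hf)⟩

theorem Fin.one_add_one_ne_zero {n : ℕ} [NeZero n] (hn : 3 ≤ n) : (1 + 1 : Fin n) ≠ 0 := by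
  intro h
  have h' := congrArg Fin.val h
  rw [Fin.val_add, Fin.val_one', Nat.mod_eq_of_lt (by omega : 1 < n),
    Nat.mod_eq_of_lt (by omega : 1 + 1 < n)] at h'
  simp at h'

/-- In a cycle, a set of edges no two of which are consecutive is a matching; the edge
`s(i, i + 1)` is represented by its initial vertex `i`. -/
theorem exists_isMatchingSet_cycleGraph {n : ℕ} [NeZero n] (hn : 3 ≤ n) (S : Finset (Fin n))
    (hS : ∀ i ∈ S, i + 1 ∉ S) :
    ∃ M : Finset (Sym2 (Fin n)), IsMatchingSet (cycleGraph n) M ∧ M.card = S.card ∧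
      ∀ e ∈ M, ∃ i ∈ S, e = s(i, i + 1) := by
  have h2 := Fin.one_add_one_ne_zero hn
  refine ⟨S.image fun i => s(i, i + 1), ⟨?_, ?_⟩, ?_, ?_⟩
  · intro e he
    obtain ⟨i, -, rfl⟩ := Finset.mem_image.1 he
    rw [mem_edgeSet, cycleGraph_adj']
    right
    rw [add_sub_cancel_left, Fin.val_one', Nat.mod_eq_of_lt (by omega)]
  · intro e he f hf hef v hv hv'
    obtain ⟨i, hi, rfl⟩ := Finset.mem_image.1 he
    obtain ⟨j, hj, rfl⟩ := Finset.mem_image.1 hf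
    rw [Sym2.mem_iff] at hv hv'
    rcases hv with rfl | rfl <;> rcases hv' with h | h
    · exact hef (by rw [h])
    · exact hS j hj (h ▸ hi)
    · exact hS i hi (h ▸ hj)
    · exact hef (by rw [add_right_cancel h])
  · refine Finset.card_image_of_injective _ fun i j hij => ?_
    rcases Sym2.eq_iff.1 hij with h | ⟨h, h'⟩
    · exact h.1
    · rw [h, add_assoc] at h'
      exact absurd (left_eq_add.1 h'.symm) h2
  · intro e he
    obtain ⟨i, hi, rfl⟩ := Finset.mem_image.1 he
    exact ⟨i, hi, rfl⟩

/-- Greedy choice along a coloured path with edge colours `d 0, d 1, …`: an edge is chosen unless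
its predecessor is chosen and has the same colour. -/
def greedyChoice {α : Type*} (d : ℕ → α) : ℕ → Prop
  | 0 => True
  | i + 1 => greedyChoice d i → d (i + 1) ≠ d i

open Classical in
theorem succ_le_card_filter_greedyChoice {α : Type*} (d : ℕ → α) (k : ℕ) :
    k + 1 ≤ ((Finset.range (2 * k + 1)).filter (greedyChoice d)).card := by
  induction k with
  | zero => simp [Finset.filter_singleton, greedyChoice]
  | succ k ih =>
    rw [show 2 * (k + 1) + 1 = 2 * k + 1 + 1 + 1 by ring, Finset.range_add_one,
      Finset.filter_insert, Finset.range_add_one, Finset.filter_insert]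
    by_cases h : greedyChoice d (2 * k + 1)
    · have hle : ((Finset.range (2 * k + 1)).filter (greedyChoice d)).card + 1 ≤
          (insert (2 * k + 1) ((Finset.range (2 * k + 1)).filter (greedyChoice d))).card := by
        rw [Finset.card_insert_of_notMem (by simp)]
      rw [if_pos h]
      split_ifs
      · exact (Nat.succ_le_succ ih).trans
          (hle.trans (Finset.card_le_card (Finset.subset_insert _ _)))
      · exact (Nat.succ_le_succ ih).trans hle
    · have h' : greedyChoice d (2 * k + 1 + 1) := fun h0 => absurd h0 h
      rw [if_neg h, if_pos h', Finset.card_insert_of_notMem (by simp)]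
      exact Nat.succ_le_succ ih

/-- `C_{2k+1}` has a matching with `k` edges. -/
theorem exists_isMatchingSet_cycleGraph_card_eq {k : ℕ} (hk : 1 ≤ k) :
    ∃ M : Finset (Sym2 (Fin (2 * k + 1))),
      IsMatchingSet (cycleGraph (2 * k + 1)) M ∧ M.card = k ∧
        ∀ e ∈ M, ∃ i, e = s(i, i + 1) := by
  let f : Fin k ↪ Fin (2 * k + 1) :=
    ⟨fun j => ⟨2 * j, by omega⟩, fun i j h => by
      have := congrArg Fin.val h
      simp only at this
      omega⟩
  obtain ⟨M, hM, hcard, hMS⟩ := exists_isMatchingSet_cycleGraph (by omega : 3 ≤ 2 * k + 1)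
    (Finset.univ.map f) (by
      intro i hi hi'
      obtain ⟨a, -, rfl⟩ := Finset.mem_map.1 hi
      obtain ⟨b, -, hb⟩ := Finset.mem_map.1 hi'
      have h : 2 * b.val = (f a + 1).val := congrArg Fin.val hb
      have ha : (f a).val = 2 * a.val := rfl
      rw [Fin.val_add_one_of_lt' (by omega), ha] at h
      omega)
  refine ⟨M, hM, by simpa using hcard, fun e he => ?_⟩
  obtain ⟨i, -, h⟩ := hMS e he
  exact ⟨i, h⟩

theorem matchingNumber_cycleGraph_odd {k : ℕ} (hk : 1 ≤ k) :
    matchingNumber (cycleGraph (2 * k + 1)) = k := by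
  refine IsGreatest.csSup_eq ⟨?_, ?_⟩
  · obtain ⟨M, hM, hcard, -⟩ := exists_isMatchingSet_cycleGraph_card_eq hk
    exact ⟨M, hM, hcard⟩
  · rintro n ⟨M, hM, rfl⟩
    have := hM.two_mul_card_le
    rw [Fintype.card_fin] at this
    omega

/-- A function on `Fin (n + 1)` that is invariant under `i ↦ i + 1` is constant. -/
theorem Fin.apply_eq_apply_zero_of_forall_add_one {α : Type*} {n : ℕ} (d : Fin (n + 1) → α)
    (hd : ∀ i, d (i + 1) = d i) (i : Fin (n + 1)) : d i = d 0 := by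
  induction i using Fin.induction with
  | zero => rfl
  | succ i ih => rw [← Fin.coeSucc_eq_succ, hd, ih]

/-- If two consecutive edges of `C_{2k+1}` have different colours, then there are matchings,
one in each colour, that together have at least `k + 1` edges. -/
theorem exists_isMatchingSet_of_colour_change {k : ℕ} (hk : 1 ≤ k)
    (d : Fin (2 * k + 1) → Fin 2) (a : Fin (2 * k + 1)) (ha : d (a + 1) ≠ d a) :
    ∃ M : Fin 2 → Finset (Sym2 (Fin (2 * k + 1))),
      (∀ j, IsMatchingSet (cycleGraph (2 * k + 1)) (M j) ∧
        ∀ e ∈ M j, ∃ i, d i = j ∧ e = s(i, i + 1)) ∧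
      k + 1 ≤ (M 0).card + (M 1).card := by
  classical
  let d' : ℕ → Fin 2 := fun i => d (Fin.ofNat _ i + (a + 1))
  let P : Fin (2 * k + 1) → Prop := fun x => greedyChoice d' (x - (a + 1)).val
  let S : Fin 2 → Finset (Fin (2 * k + 1)) := fun j => Finset.univ.filter fun x => P x ∧ d x = j
  have hS : ∀ j, ∀ x ∈ S j, x + 1 ∉ S j := by
    intro j x hx hx'
    obtain ⟨hP, rfl⟩ := (Finset.mem_filter.1 hx).2
    obtain ⟨hP', hd⟩ := (Finset.mem_filter.1 hx').2
    obtain ⟨y, rfl⟩ : ∃ y, x = y + (a + 1) := ⟨x - (a + 1), by simp⟩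
    have hy : y + (a + 1) + 1 - (a + 1) = y + 1 := by abel
    simp only [P, hy, add_sub_cancel_right] at hP hP'
    by_cases hlast : y = Fin.last _
    · subst hlast
      have h0 : Fin.last (2 * k) + (a + 1) = a := by
        rw [add_comm a, ← add_assoc, Fin.last_add_one, zero_add]
      rw [h0] at hd
      exact ha hd
    · rw [Fin.val_add_one_of_lt (Fin.lt_last_iff_ne_last.2 hlast)] at hP'
      refine hP' hP ?_
      have h1 : Fin.ofNat (2 * k + 1) (y.val + 1) = y + 1 := by
        ext
        rw [Fin.val_add_one_of_lt (Fin.lt_last_iff_ne_last.2 hlast)]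
        have := Fin.val_lt_last hlast
        simp only [Fin.val_ofNat]
        exact Nat.mod_eq_of_lt (by omega)
      have h2 : Fin.ofNat (2 * k + 1) y.val = y := by
        ext
        simp only [Fin.val_ofNat]
        exact Nat.mod_eq_of_lt y.isLt
      simp only [d', h1, h2]
      rw [← hd]
      congr 1
      abel
  choose M hM hcard hMS using fun j =>
    exists_isMatchingSet_cycleGraph (by omega : 3 ≤ 2 * k + 1) (S j) (hS j)
  refine ⟨M, fun j => ⟨hM j, fun e he => ?_⟩, ?_⟩
  · obtain ⟨i, hi, h⟩ := hMS j e he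
    exact ⟨i, (Finset.mem_filter.1 hi).2.2, h⟩
  · rw [hcard, hcard]
    refine (succ_le_card_filter_greedyChoice d' k).trans
      (le_trans ?_ (Finset.card_union_le (S 0) (S 1)))
    refine Finset.card_le_card_of_injOn (fun i => Fin.ofNat _ i + (a + 1)) ?_ ?_
    · intro i hi
      simp only [Finset.coe_filter, Finset.mem_range, Set.mem_ofPred_eq] at hi
      have hP : P (Fin.ofNat _ i + (a + 1)) := by
        simp only [P, add_sub_cancel_right, Fin.val_ofNat, Nat.mod_eq_of_lt hi.1]
        exact hi.2
      simp only [Finset.coe_union, Set.mem_union, Finset.mem_coe, S, Finset.mem_filter,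
        Finset.mem_univ, true_and, hP]
      omega
    · intro i hi j hj hij
      simp only [Finset.coe_filter, Finset.mem_range, Set.mem_ofPred_eq] at hi hj
      have h := congrArg Fin.val (add_right_cancel hij)
      rwa [Fin.val_ofNat, Fin.val_ofNat, Nat.mod_eq_of_lt hi.1, Nat.mod_eq_of_lt hj.1] at h

theorem arrowsMatch_cycleGraph_odd {k : ℕ} (hk : 2 ≤ k) :
    ArrowsMatch (cycleGraph (2 * k + 1)) ![k / 2 + 1, (k + 1) / 2 + 1] := by
  intro c
  suffices h : ∃ (j : Fin 2) (M : Finset (Sym2 (Fin (2 * k + 1)))),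
      IsMatchingSet (cycleGraph (2 * k + 1)) M ∧
        (![k / 2 + 1, (k + 1) / 2 + 1] : Fin 2 → ℕ) j ≤ M.card ∧ ∀ e ∈ M, c e = j by
    obtain ⟨j, M, hM, hcard, hc⟩ := h
    obtain ⟨N, hN, hNcard⟩ := Finset.exists_subset_card_eq hcard
    exact ⟨j, N, hM.subset hN, hNcard, fun e he => hc e (hN he)⟩
  by_cases hmono : ∀ i : Fin (2 * k + 1), c s(i + 1, i + 1 + 1) = c s(i, i + 1)
  · have hconst := Fin.apply_eq_apply_zero_of_forall_add_one (fun i => c s(i, i + 1)) hmono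
    obtain ⟨M, hM, hcard, hMe⟩ := exists_isMatchingSet_cycleGraph_card_eq (by omega : 1 ≤ k)
    refine ⟨c s(0, 0 + 1), M, hM, ?_, fun e he => ?_⟩
    · rw [hcard]
      generalize c s((0 : Fin (2 * k + 1)), 0 + 1) = j
      fin_cases j <;> simp <;> omega
    · obtain ⟨i, rfl⟩ := hMe e he
      exact hconst i
  · push Not at hmono
    obtain ⟨a, ha⟩ := hmono
    obtain ⟨M, hM, hcard⟩ :=
      exists_isMatchingSet_of_colour_change (by omega : 1 ≤ k) (fun i => c s(i, i + 1)) a ha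
    have hc : ∀ j, ∀ e ∈ M j, c e = j := by
      intro j e he
      obtain ⟨i, hi, rfl⟩ := (hM j).2 e he
      exact hi
    rcases le_or_gt (k / 2 + 1) (M 0).card with h | h
    · exact ⟨0, M 0, (hM 0).1, h, hc 0⟩
    · refine ⟨1, M 1, (hM 1).1, ?_, hc 1⟩
      simp only [Matrix.cons_val_one, Matrix.cons_val_fin_one]
      omega

/-- **Proposition 4.3.** For odd `ℓ = 2k + 1 ≥ 5`, with `r = ⌊k/2⌋ + 1` and
`b = ⌈k/2⌉ + 1`, the cycle `C_ℓ` satisfies `C_ℓ → (r, b)K₂`, and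
`Λ_{(r,b)} = r + b - 2 = k = ν(C_ℓ)`; in particular `C_ℓ` is `2`-weakly
Cockayne–Lorimer. -/
theorem odd_cycle_wCL (k : ℕ) (hk : 2 ≤ k) :
    ArrowsMatch (SimpleGraph.cycleGraph (2 * k + 1)) ![k / 2 + 1, (k + 1) / 2 + 1] ∧
    (k / 2 + 1) + ((k + 1) / 2 + 1) - 2 = k ∧
    matchingNumber (SimpleGraph.cycleGraph (2 * k + 1)) = k ∧
    ∃ t : Fin 2 → ℕ, (∀ j, 1 ≤ t j) ∧
      matchingNumber (SimpleGraph.cycleGraph (2 * k + 1)) ≤ ∑ j, (t j - 1) ∧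
      ArrowsMatch (SimpleGraph.cycleGraph (2 * k + 1)) t := by
  have harr := arrowsMatch_cycleGraph_odd hk
  have hnu := matchingNumber_cycleGraph_odd (by omega : 1 ≤ k)
  refine ⟨harr, by omega, hnu, _, fun j => ?_, ?_, harr⟩
  · fin_cases j <;> simp
  · rw [hnu]
    simp only [Fin.sum_univ_two, Matrix.cons_val_zero, Matrix.cons_val_one,
      Matrix.cons_val_fin_one]
    omega
end

section
/- Fix integers q ≥ 1 and s ≥ 2, and let G be the complete split graph consisting of a clique on vertices c_1,…,c_q completely joined to an independent set of size 2s−1. Then G is an s-connector, |V(G)| = q + 2s − 1 = ‖t‖_∞ + Λ_t + 2s − 3 for t = (2,2,…,2) ∈ ℕ_+^q, and G ↛ tK_2: the colouring assigning each edge e the minimum j ∈ {1,…,q} with c_j ∈ e makes every colour class a star, so every monochromatic matching has size at most 1. -/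
open SimpleGraph

variable {V : Type*}

/-- If every edge `e` of `G` contains the vertex `centre (c e)`, then each colour class of `c`
is a star, so `c` has no monochromatic matching of size two. -/
theorem not_arrowsMatch_two_of_star {G : SimpleGraph V} {q : ℕ} (centre : Fin q → V)
    (c : Sym2 V → Fin q) (hc : ∀ e ∈ G.edgeSet, centre (c e) ∈ e) :
    ¬ ArrowsMatch G (fun _ : Fin q => 2) := by
  intro h
  obtain ⟨j, M, ⟨hMG, hM⟩, hcard, hj⟩ := h c
  obtain ⟨e, he, f, hf, hef⟩ := Finset.one_lt_card.mp (hcard ▸ one_lt_two : 1 < M.card)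
  have hje := hc e (hMG e he)
  have hjf := hc f (hMG f hf)
  rw [hj e he] at hje
  rw [hj f hf] at hjf
  exact hM e he f hf hef _ hje hjf

/-- The complete split graph with clique `α` and independent set `β` is an `s`-connector when
`β` has fewer than `2 * s` elements. -/
theorem isConnector_fromRel_isLeft {α β : Type*} [Finite α] [Finite β] {s : ℕ}
    (hβ : Nat.card β < 2 * s) :
    IsConnector (SimpleGraph.fromRel (fun a _ : α ⊕ β => a.isLeft = true)) s := by
  intro X Y hXY hX hY
  by_contra! hno
  have hne : ∀ x ∈ X, ∀ y ∈ Y, x ≠ y := fun x hx y hy => hXY.ne_of_mem hx hy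
  have hright : ∀ x ∈ X, ∀ y ∈ Y, x ∈ Set.range Sum.inr ∧ y ∈ Set.range Sum.inr := by
    intro x hx y hy
    have hxy := hno x hx y hy
    rw [SimpleGraph.fromRel_adj] at hxy
    cases x <;> cases y <;> simp_all
  have hXne : X.Nonempty := Set.nonempty_of_ncard_ne_zero (by omega)
  have hYne : Y.Nonempty := Set.nonempty_of_ncard_ne_zero (by omega)
  have hsub : X ∪ Y ⊆ Set.range (Sum.inr : β → α ⊕ β) :=
    Set.union_subset (fun x hx => (hright x hx _ hYne.some_mem).1)
      (fun y hy => (hright _ hXne.some_mem y hy).2)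
  have hle := Set.ncard_le_ncard hsub
  rw [Set.ncard_union_eq hXY, Set.ncard_range_of_injective Sum.inr_injective] at hle
  omega

/-- **The complete split graph example.** For `q ≥ 1` and `s ≥ 2`, the complete split
graph `G` with clique `c₁, …, c_q` completely joined to an independent set of size
`2s - 1` is an `s`-connector on `q + 2s - 1 = ‖t‖_∞ + Λ_t + 2s - 3` vertices for
`t = (2, …, 2) ∈ ℕ₊^q`, yet `G ↛ tK₂`. -/
theorem complete_split_graph_example (q s : ℕ) (hq : 1 ≤ q) (hs : 2 ≤ s) :
    IsConnector
      (SimpleGraph.fromRel (fun a _ : Fin q ⊕ Fin (2 * s - 1) => a.isLeft = true)) s ∧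
    Fintype.card (Fin q ⊕ Fin (2 * s - 1)) = q + 2 * s - 1 ∧
    q + 2 * s - 1
      = Finset.univ.sup (fun _ : Fin q => 2) + (∑ _j : Fin q, (2 - 1)) + 2 * s - 3 ∧
    ¬ ArrowsMatch
      (SimpleGraph.fromRel (fun a _ : Fin q ⊕ Fin (2 * s - 1) => a.isLeft = true))
      (fun _ : Fin q => 2) := by
  refine ⟨isConnector_fromRel_isLeft (by rw [Nat.card_fin]; omega), ?_, ?_, ?_⟩
  · rw [Fintype.card_sum, Fintype.card_fin, Fintype.card_fin]
    omega
  · have : Nonempty (Fin q) := ⟨⟨0, hq⟩⟩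
    rw [Finset.sup_const Finset.univ_nonempty]
    simp
    omega
  · have hcolour : ∀ e : Sym2 (Fin q ⊕ Fin (2 * s - 1)), ∃ j : Fin q,
        e ∈ (SimpleGraph.fromRel
          (fun a _ : Fin q ⊕ Fin (2 * s - 1) => a.isLeft = true)).edgeSet → Sum.inl j ∈ e := by
      intro e
      induction e with
      | _ a b =>
        rcases a with a | a
        · exact ⟨a, fun _ => Sym2.mem_mk_left _ _⟩
        rcases b with b | b
        · exact ⟨b, fun _ => Sym2.mem_mk_right _ _⟩
        exact ⟨⟨0, hq⟩, by simp⟩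
    choose c hc using hcolour
    exact not_arrowsMatch_two_of_star Sum.inl c hc
end

section
/- (Gallai–Edmonds stability) Let G = (V,E) be a finite graph with Gallai–Edmonds decomposition GE(G) = (C,A,D), let v ∈ A, and let G' = G − v be the induced subgraph on V ∖ {v}. Then GE(G') = (C, A ∖ {v}, D). -/
open SimpleGraph

variable {V : Type*}

namespace IsMatchingSet

open Classical in
theorem insert {G : SimpleGraph V} {M : Finset (Sym2 V)} (hM : IsMatchingSet G M) {a b : V}
    (hab : G.Adj a b) (ha : ∀ e ∈ M, a ∉ e) (hb : ∀ e ∈ M, b ∉ e) :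
    IsMatchingSet G (insert s(a, b) M) ∧ (insert s(a, b) M).card = M.card + 1 := by
  refine ⟨⟨?_, ?_⟩, Finset.card_insert_of_notMem fun h => ha _ h (Sym2.mem_mk_left a b)⟩
  · intro e he
    rcases Finset.mem_insert.1 he with rfl | he
    · exact hab
    · exact hM.1 e he
  · intro e he f hf hne t hte htf
    rcases Finset.mem_insert.1 he with rfl | heM <;> rcases Finset.mem_insert.1 hf with rfl | hfM
    · exact hne rfl
    · rcases Sym2.mem_iff.1 hte with rfl | rfl
      · exact ha f hfM htf
      · exact hb f hfM htf
    · rcases Sym2.mem_iff.1 htf with rfl | rfl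
      · exact ha e heM hte
      · exact hb e heM hte
    · exact hM.2 e heM f hfM hne t hte htf

theorem subset_s19 {G : SimpleGraph V} {M N : Finset (Sym2 V)} (hM : IsMatchingSet G M)
    (hN : N ⊆ M) : IsMatchingSet G N :=
  ⟨fun e he => hM.1 e (hN he), fun e he f hf => hM.2 e (hN he) f (hN hf)⟩

open Classical in
theorem notMem_of_mem_erase {G : SimpleGraph V} {M : Finset (Sym2 V)} (hM : IsMatchingSet G M)
    {e : Sym2 V} (he : e ∈ M) {t : V} (ht : t ∈ e) : ∀ f ∈ M.erase e, t ∉ f := fun f hf =>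
  hM.2 e he f (Finset.mem_of_mem_erase hf) (Finset.ne_of_mem_erase hf).symm t ht

theorem card_le_matchingNumber_s19 [Finite V] {G : SimpleGraph V} {M : Finset (Sym2 V)}
    (hM : IsMatchingSet G M) : M.card ≤ matchingNumber G := by
  have := Fintype.ofFinite (Sym2 V)
  refine le_csSup ⟨Fintype.card (Sym2 V), ?_⟩ ⟨M, hM, rfl⟩
  rintro n ⟨N, -, rfl⟩
  exact Finset.card_le_univ N

/-- Switching two matchings along the alternating path that starts at a vertex `u` covered by `M`
but not by `N`: either the path has even length, and switching turns `M` into a matching of the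
same size missing `u`, or it has odd length and ends at some `z ≠ u`, and switching moves the
coverage of `u` and `z` from `M` to `N`. -/
theorem exists_switch {G : SimpleGraph V} {M N : Finset (Sym2 V)} (hM : IsMatchingSet G M)
    (hN : IsMatchingSet G N) {u : V} (huM : ∃ e ∈ M, u ∈ e) (huN : ∀ e ∈ N, u ∉ e) :
    (∃ M' : Finset (Sym2 V), IsMatchingSet G M' ∧ M'.card = M.card ∧ (∀ e ∈ M', u ∉ e) ∧
      ∀ t, (∃ e ∈ M', t ∈ e) → (∃ e ∈ M, t ∈ e) ∨ ∃ e ∈ N, t ∈ e) ∨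
    ∃ z ≠ u, (∃ e ∈ M, z ∈ e) ∧ ∃ M' N' : Finset (Sym2 V),
      IsMatchingSet G M' ∧ M'.card + 1 = M.card ∧
      (∀ t, (∃ e ∈ M', t ∈ e) → (∃ e ∈ M, t ∈ e) ∧ t ≠ u ∧ t ≠ z) ∧
      IsMatchingSet G N' ∧ N'.card = N.card + 1 ∧
      ∀ t, (∃ e ∈ N', t ∈ e) → (∃ e ∈ N, t ∈ e) ∨ t = u ∨ t = z := by
  classical
  induction hn : M.card generalizing M N u with
  | zero => simp_all
  | succ n ih =>
    obtain ⟨e, he, hue⟩ := huM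
    obtain ⟨x, rfl⟩ := Sym2.mem_iff_exists.1 hue
    have hux : G.Adj u x := hM.1 _ he
    have hM₁ := hM.subset_s19 (Finset.erase_subset s(u, x) M)
    have hcM := Finset.card_erase_add_one he
    have huM₁ := hM.notMem_of_mem_erase he (Sym2.mem_mk_left u x)
    have hxM₁ := hM.notMem_of_mem_erase he (Sym2.mem_mk_right u x)
    have hM₁M : ∀ f ∈ M.erase s(u, x), f ∈ M := fun f hf => Finset.mem_of_mem_erase hf
    generalize M.erase s(u, x) = M₁ at *
    by_cases hxN : ∀ f ∈ N, x ∉ f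
    · obtain ⟨hN', hcN'⟩ := hN.insert hux huN hxN
      refine Or.inr ⟨x, hux.ne', ⟨_, he, Sym2.mem_mk_right u x⟩, M₁, _, hM₁, by omega, ?_, hN',
        hcN', ?_⟩
      · rintro t ⟨f, hf, htf⟩
        exact ⟨⟨f, hM₁M f hf, htf⟩, fun h => huM₁ f hf (h ▸ htf), fun h => hxM₁ f hf (h ▸ htf)⟩
      · simp only [Finset.mem_insert]
        rintro t ⟨f, rfl | hf, htf⟩
        · exact Or.inr (Sym2.mem_iff.1 htf)
        · exact Or.inl ⟨f, hf, htf⟩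
    · push Not at hxN
      obtain ⟨f, hf, hxf⟩ := hxN
      obtain ⟨y, rfl⟩ := Sym2.mem_iff_exists.1 hxf
      have hxy : G.Adj x y := hN.1 _ hf
      have huy : u ≠ y := fun h => huN _ hf (h ▸ Sym2.mem_mk_right x y)
      have hN₁ := hN.subset_s19 (Finset.erase_subset s(x, y) N)
      have hcN := Finset.card_erase_add_one hf
      have hxN₁ := hN.notMem_of_mem_erase hf (Sym2.mem_mk_left x y)
      have hyN₁ := hN.notMem_of_mem_erase hf (Sym2.mem_mk_right x y)
      have hN₁N : ∀ g ∈ N.erase s(x, y), g ∈ N := fun g hg => Finset.mem_of_mem_erase hg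
      generalize N.erase s(x, y) = N₁ at *
      have key : ∀ M₂ : Finset (Sym2 V), IsMatchingSet G M₂ → M₂.card = M₁.card →
          (∀ e ∈ M₂, y ∉ e) →
          (∀ t, (∃ e ∈ M₂, t ∈ e) → (∃ e ∈ M₁, t ∈ e) ∨ ∃ e ∈ N₁, t ∈ e) →
          ∃ M' : Finset (Sym2 V), IsMatchingSet G M' ∧ M'.card = n + 1 ∧ (∀ e ∈ M', u ∉ e) ∧
            ∀ t, (∃ e ∈ M', t ∈ e) → (∃ e ∈ M, t ∈ e) ∨ ∃ e ∈ N, t ∈ e := by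
        intro M₂ hM₂ hc hy hcov
        have hx : ∀ e ∈ M₂, x ∉ e := fun e he hxe => by
          rcases hcov x ⟨e, he, hxe⟩ with ⟨g, hg, hxg⟩ | ⟨g, hg, hxg⟩
          exacts [hxM₁ g hg hxg, hxN₁ g hg hxg]
        obtain ⟨hM', hcM'⟩ := hM₂.insert hxy hx hy
        refine ⟨_, hM', by omega, ?_, ?_⟩
        · simp only [Finset.mem_insert]
          rintro e (rfl | he) hue
          · exact huN _ hf hue
          · rcases hcov u ⟨e, he, hue⟩ with ⟨g, hg, hug⟩ | ⟨g, hg, hug⟩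
            exacts [huM₁ g hg hug, huN g (hN₁N g hg) hug]
        · simp only [Finset.mem_insert]
          rintro t ⟨e, rfl | he, hte⟩
          · exact Or.inr ⟨_, hf, hte⟩
          · rcases hcov t ⟨e, he, hte⟩ with ⟨g, hg, htg⟩ | ⟨g, hg, htg⟩
            exacts [Or.inl ⟨g, hM₁M g hg, htg⟩, Or.inr ⟨g, hN₁N g hg, htg⟩]
      by_cases hyM₁ : ∀ e ∈ M₁, y ∉ e
      · exact Or.inl (key M₁ hM₁ rfl hyM₁ fun t => Or.inl)
      push Not at hyM₁
      rcases ih hM₁ hN₁ hyM₁ hyN₁ (by omega) with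
        ⟨M₂, hM₂, hc, hy, hcov⟩ | ⟨z, hzy, ⟨d, hd, hzd⟩, M₂, N₂, hM₂, hcM₂, hcovM, hN₂, hcN₂, hcovN⟩
      · exact Or.inl (key M₂ hM₂ (by omega) hy hcov)
      · have hzu : z ≠ u := fun h => huM₁ d hd (h ▸ hzd)
        have hzx : z ≠ x := fun h => hxM₁ d hd (h ▸ hzd)
        obtain ⟨hM', hcM'⟩ := hM₂.insert hxy
          (fun e he hxe => by
            obtain ⟨⟨g, hg, hxg⟩, -⟩ := hcovM x ⟨e, he, hxe⟩
            exact hxM₁ g hg hxg)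
          (fun e he hye => (hcovM y ⟨e, he, hye⟩).2.1 rfl)
        obtain ⟨hN', hcN'⟩ := hN₂.insert hux
          (fun e he hue => by
            rcases hcovN u ⟨e, he, hue⟩ with ⟨g, hg, hug⟩ | h | h
            exacts [huN g (hN₁N g hg) hug, huy h, hzu h.symm])
          (fun e he hxe => by
            rcases hcovN x ⟨e, he, hxe⟩ with ⟨g, hg, hxg⟩ | h | h
            exacts [hxN₁ g hg hxg, hxy.ne h, hzx h.symm])
        refine Or.inr ⟨z, hzu, ⟨d, hM₁M d hd, hzd⟩, _, _, hM', by omega, ?_, hN', by omega, ?_⟩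
        · simp only [Finset.mem_insert]
          rintro t ⟨e, rfl | he', hte⟩
          · rcases Sym2.mem_iff.1 hte with rfl | rfl
            · exact ⟨⟨_, he, Sym2.mem_mk_right u t⟩, hux.ne', hzx.symm⟩
            · obtain ⟨g, hg, htg⟩ := hyM₁
              exact ⟨⟨g, hM₁M g hg, htg⟩, huy.symm, hzy.symm⟩
          · obtain ⟨⟨g, hg, htg⟩, -, htz⟩ := hcovM t ⟨e, he', hte⟩
            exact ⟨⟨g, hM₁M g hg, htg⟩, fun h => huM₁ g hg (h ▸ htg), htz⟩
        · simp only [Finset.mem_insert]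
          rintro t ⟨e, rfl | he', hte⟩
          · rcases Sym2.mem_iff.1 hte with rfl | rfl
            · exact Or.inr (Or.inl rfl)
            · exact Or.inl ⟨_, hf, Sym2.mem_mk_left t y⟩
          · rcases hcovN t ⟨e, he', hte⟩ with ⟨g, hg, htg⟩ | rfl | rfl
            · exact Or.inl ⟨g, hN₁N g hg, htg⟩
            · exact Or.inl ⟨_, hf, Sym2.mem_mk_right x t⟩
            · exact Or.inr (Or.inr rfl)

end IsMatchingSet

theorem exists_isMatchingSet_card_eq_matchingNumber [Finite V] (G : SimpleGraph V) :
    ∃ M : Finset (Sym2 V), IsMatchingSet G M ∧ M.card = matchingNumber G := by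
  have := Fintype.ofFinite (Sym2 V)
  refine Nat.sSup_mem (s := {n | ∃ M : Finset (Sym2 V), IsMatchingSet G M ∧ M.card = n})
    ⟨0, ∅, ⟨by simp, by simp⟩, rfl⟩ ⟨Fintype.card (Sym2 V), ?_⟩
  rintro n ⟨N, -, rfl⟩
  exact Finset.card_le_univ N

/-- Matchings of an induced subgraph are the matchings of the graph whose edges lie in the
vertex set. -/
theorem exists_isMatchingSet_induce_iff {G : SimpleGraph V} {s : Set V} {n : ℕ} {T : Set s} :
    (∃ M : Finset (Sym2 s), IsMatchingSet (G.induce s) M ∧ M.card = n ∧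
      ∀ u ∈ T, ∀ e ∈ M, u ∉ e) ↔
    ∃ M : Finset (Sym2 V), IsMatchingSet G M ∧ M.card = n ∧ (∀ e ∈ M, ∀ u ∈ e, u ∈ s) ∧
      ∀ u ∈ T, ∀ e ∈ M, u.1 ∉ e := by
  classical
  have hinj : Function.Injective (Sym2.map (Subtype.val : s → V)) :=
    Sym2.map.injective Subtype.val_injective
  have hmem : ∀ (e : Sym2 s) (u : s), u.1 ∈ Sym2.map Subtype.val e ↔ u ∈ e := by
    intro e u
    simp [Sym2.mem_map]
  have hedge : ∀ e : Sym2 s, Sym2.map Subtype.val e ∈ G.edgeSet ↔ e ∈ (G.induce s).edgeSet := by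
    intro e
    induction e with | _ a b => simp
  constructor
  · rintro ⟨M, hM, hc, hT⟩
    refine ⟨M.image (Sym2.map Subtype.val), ⟨?_, ?_⟩,
      (Finset.card_image_of_injective _ hinj).trans hc, ?_, ?_⟩
    · simp only [Finset.forall_mem_image, hedge]
      exact hM.1
    · simp only [Finset.forall_mem_image]
      intro e he f hf hne t hte htf
      obtain ⟨t, -, rfl⟩ := Sym2.mem_map.1 hte
      exact hM.2 e he f hf (fun h => hne (h ▸ rfl)) t ((hmem e t).1 hte) ((hmem f t).1 htf)
    · simp only [Finset.forall_mem_image]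
      intro e he t hte
      obtain ⟨t, -, rfl⟩ := Sym2.mem_map.1 hte
      exact t.2
    · simp only [Finset.forall_mem_image, hmem]
      exact fun u hu e he => hT u hu e he
  · rintro ⟨M, hM, hc, hs, hT⟩
    have hrange : ∀ e ∈ M, e ∈ Set.range (Sym2.map (Subtype.val : s → V)) := by
      intro e he
      have := hs e he
      induction e with | _ a b =>
      exact ⟨s(⟨a, this a (Sym2.mem_mk_left a b)⟩, ⟨b, this b (Sym2.mem_mk_right a b)⟩), rfl⟩
    refine ⟨M.preimage _ hinj.injOn, ⟨?_, ?_⟩, ?_, ?_⟩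
    · simp only [Finset.mem_preimage, ← hedge]
      exact fun e he => hM.1 _ he
    · simp only [Finset.mem_preimage]
      intro e he f hf hne t hte htf
      exact hM.2 _ he _ hf (hinj.ne hne) t ((hmem e t).2 hte) ((hmem f t).2 htf)
    · rw [← hc, ← Finset.card_image_of_injective _ hinj, Finset.image_preimage,
        Finset.filter_true_of_mem hrange]
    · simp only [Finset.mem_preimage]
      exact fun u hu e he hue => hT u hu _ he ((hmem e u).2 hue)

/-- Deleting an essential vertex lowers the matching number by one. -/
theorem matchingNumber_induce_ne_add_one [Finite V] {G : SimpleGraph V} {v : V}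
    (hv : v ∉ geD G) : matchingNumber (G.induce {u : V | u ≠ v}) + 1 = matchingNumber G := by
  classical
  apply le_antisymm
  · obtain ⟨M, hM, hc⟩ := exists_isMatchingSet_card_eq_matchingNumber (G.induce {u : V | u ≠ v})
    obtain ⟨N, hN, hcN, hNv, -⟩ :=
      (exists_isMatchingSet_induce_iff (T := ∅)).1 ⟨M, hM, hc, by simp⟩
    refine Nat.succ_le_of_lt ((hcN ▸ hN.card_le_matchingNumber_s19).lt_of_ne fun h => ?_)
    exact hv ⟨N, hN, hcN.trans h, fun e he hve => hNv e he v hve rfl⟩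
  · obtain ⟨M, hM, hc⟩ := exists_isMatchingSet_card_eq_matchingNumber G
    have hvM : ∃ e ∈ M, v ∈ e := by
      by_contra! h
      exact hv ⟨M, hM, hc, h⟩
    obtain ⟨e, he, hve⟩ := hvM
    obtain ⟨N, hN, hcN, -⟩ := (exists_isMatchingSet_induce_iff (s := {u : V | u ≠ v}) (T := ∅)).2
      ⟨M.erase e, hM.subset_s19 (Finset.erase_subset e M), rfl,
        fun f hf t htf h => hM.notMem_of_mem_erase he hve f hf (h ▸ htf), by simp⟩
    have := hN.card_le_matchingNumber_s19
    have := Finset.card_erase_add_one he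
    omega

theorem geD_induce_ne [Finite V] {G : SimpleGraph V} {v : V} (hv : v ∈ geA G) :
    geD (G.induce {u : V | u ≠ v}) = Subtype.val ⁻¹' geD G := by
  classical
  obtain ⟨hvD, w, ⟨M, hM, hcM, hwM⟩, hvw⟩ := hv
  have hν := matchingNumber_induce_ne_add_one hvD
  ext u
  constructor
  · rintro ⟨N, hN, hcN, huN⟩
    obtain ⟨N, hN, hcN, hNv, huN⟩ :=
      (exists_isMatchingSet_induce_iff (T := {u})).1 ⟨N, hN, hcN, by simpa using huN⟩
    replace huN := huN u rfl
    by_contra huD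
    have huM : ∃ e ∈ M, u.1 ∈ e := by
      by_contra! h
      exact huD ⟨M, hM, hcM, h⟩
    rcases hM.exists_switch hN huM huN with
      ⟨M', hM', hcM', huM', -⟩ | ⟨z, hzu, -, M', N', hM', hcM', hcovM, hN', hcN', hcovN⟩
    · exact huD ⟨M', hM', hcM'.trans hcM, huM'⟩
    · by_cases hzv : z = v
      · subst hzv
        obtain ⟨hK, hcK⟩ := hM'.insert hvw (fun e he hze => (hcovM z ⟨e, he, hze⟩).2.2 rfl)
          (fun e he hwe => by
            obtain ⟨⟨g, hg, hwg⟩, -⟩ := hcovM w ⟨e, he, hwe⟩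
            exact hwM g hg hwg)
        refine huD ⟨_, hK, by omega, ?_⟩
        simp only [Finset.mem_insert]
        rintro e (rfl | he) hue
        · rcases Sym2.mem_iff.1 hue with h | h
          · exact u.2 h
          · exact huD ⟨M, hM, hcM, h ▸ hwM⟩
        · exact (hcovM u ⟨e, he, hue⟩).2.1 rfl
      · refine hvD ⟨N', hN', by omega, fun e he hve => ?_⟩
        rcases hcovN v ⟨e, he, hve⟩ with ⟨g, hg, hvg⟩ | h | h
        exacts [hNv g hg v hvg rfl, u.2 h.symm, hzv h.symm]
  · rintro ⟨N, hN, hcN, huN⟩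
    have hvN : ∃ e ∈ N, v ∈ e := by
      by_contra! h
      exact hvD ⟨N, hN, hcN, h⟩
    obtain ⟨e, he, hve⟩ := hvN
    have hce := Finset.card_erase_add_one he
    obtain ⟨K, hK, hcK, huK⟩ :=
      (exists_isMatchingSet_induce_iff (s := {u : V | u ≠ v}) (T := {u})).2
        ⟨N.erase e, hN.subset_s19 (Finset.erase_subset e N), rfl,
          fun f hf t htf h => hN.notMem_of_mem_erase he hve f hf (h ▸ htf), by
            rintro _ rfl f hf
            exact huN f (Finset.mem_of_mem_erase hf)⟩
    exact ⟨K, hK, by omega, huK u rfl⟩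

/-- **Gallai–Edmonds stability.** If `GE(G) = (C, A, D)` and `v ∈ A`, then the induced
subgraph `G' = G - v` on `V ∖ {v}` satisfies `GE(G') = (C, A ∖ {v}, D)`. -/
theorem gallai_edmonds_stability {V : Type*} [Fintype V] (G : SimpleGraph V) (v : V)
    (hv : v ∈ geA G) :
    geC (G.induce {u : V | u ≠ v}) = Subtype.val ⁻¹' geC G ∧
    geA (G.induce {u : V | u ≠ v}) = Subtype.val ⁻¹' (geA G \ {v}) ∧
    geD (G.induce {u : V | u ≠ v}) = Subtype.val ⁻¹' geD G := by
  have hD := geD_induce_ne hv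
  have hA : geA (G.induce {u : V | u ≠ v}) = Subtype.val ⁻¹' (geA G \ {v}) := by
    ext u
    simp only [geA, hD, Set.mem_ofPred_eq, Set.mem_preimage, Set.mem_sdiff, Set.mem_singleton_iff]
    constructor
    · rintro ⟨hu, w, hw, huw⟩
      exact ⟨⟨hu, w, hw, huw⟩, u.2⟩
    · rintro ⟨⟨hu, w, hw, huw⟩, -⟩
      exact ⟨hu, ⟨w, fun h => hv.1 (h ▸ hw)⟩, hw, huw⟩
  refine ⟨?_, hA, hD⟩
  ext u
  simp only [geC, hD, hA, Set.mem_ofPred_eq, Set.mem_preimage, Set.mem_sdiff, Set.mem_singleton_iff]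
  exact and_congr_right fun _ => not_congr (and_iff_left u.2)
end
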